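/- arXiv:1612.03390 — 4 statements merged into one kernel-verified Lean document; each statement's English description precedes it below -/
import Mathlib

section
/- Let m ∈ ℕ with m ≥ 1, α ∈ (0,1], and let G be a Banach space. For every f ∈ C^{m,α}_b(ℝ^d,ℝ^d) and g ∈ C^{m,α}_b(ℝ^d,G), the composition g∘(Id+f) belongs to C^{m,α}_b(ℝ^d,G), and there exists a constant M = M(m) ≥ 1 (independent of f, g, α) such that ‖g∘(Id+f)‖_{m,α} ≤ M ‖g‖_{m,α} (1+‖f‖_{m,α})^{m+α}. -/
open Function Set Filter Topology MeasureTheory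
open scoped ENNReal NNReal

noncomputable section

section Defs

variable {E F : Type*} [NormedAddCommGroup E] [NormedSpace ℝ E]
  [NormedAddCommGroup F] [NormedSpace ℝ F]

/-- `‖f‖_n = max_{0 ≤ l ≤ n} sup_x ‖f⁽ˡ⁾(x)‖`, as an extended real. -/
def eCnb (n : ℕ) (f : E → F) : ℝ≥0∞ :=
  ⨆ (l : Fin (n + 1)) (x : E), (‖iteratedFDeriv ℝ (l : ℕ) f x‖₊ : ℝ≥0∞)

/-- The Hölder seminorm `[f]_{n,α}`, as an extended real. -/
def eHsemi (n : ℕ) (α : ℝ) (f : E → F) : ℝ≥0∞ :=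
  ⨆ (x : E) (y : E) (_ : x ≠ y),
    (‖iteratedFDeriv ℝ n f x - iteratedFDeriv ℝ n f y‖₊ : ℝ≥0∞) / edist x y ^ α

/-- The Hölder norm `‖f‖_{n,α} = max(‖f‖_n, [f]_{n,α})`, as an extended real. -/
def eHnorm (n : ℕ) (α : ℝ) (f : E → F) : ℝ≥0∞ := max (eCnb n f) (eHsemi n α f)

/-- The Hölder norm `‖f‖_{n,α}` as a real number (junk value `0` when infinite). -/
def hnorm (n : ℕ) (α : ℝ) (f : E → F) : ℝ := (eHnorm n α f).toReal

/-- Membership in the global Hölder space `C^{n,α}_b(E,F)`. -/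
def MemCb (n : ℕ) (α : ℝ) (f : E → F) : Prop :=
  ContDiff ℝ (n : ℕ∞) f ∧ eHnorm n α f < ⊤

/-- Membership in `C^{n,α}_0(E,F)`: moreover all derivatives up to order `n`
vanish at infinity. -/
def MemC0 (n : ℕ) (α : ℝ) (f : E → F) : Prop :=
  MemCb n α f ∧
    ∀ l ≤ n, Tendsto (fun x => ‖iteratedFDeriv ℝ l f x‖) (cocompact E) (𝓝 0)

end Defs

/-- `ℝ^d` -/
abbrev Euc (d : ℕ) : Type := EuclideanSpace ℝ (Fin d)

/-- Membership in the diffeomorphism group `D^{n,β}(ℝ^d)`: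
`Φ - Id ∈ C^{n,β}_0` and `det dΦ(x) > 0` everywhere. -/
def MemD (d n : ℕ) (β : ℝ) (Φ : Euc d → Euc d) : Prop :=
  MemC0 n β (fun x => Φ x - x) ∧
    ∀ x, 0 < LinearMap.det ((fderiv ℝ Φ x : Euc d →L[ℝ] Euc d) : Euc d →ₗ[ℝ] Euc d)

end

section Composition

variable {E F G : Type*} [NormedAddCommGroup E] [NormedSpace ℝ E]
  [NormedAddCommGroup F] [NormedSpace ℝ F] [NormedAddCommGroup G] [NormedSpace ℝ G]

theorem eHnorm_le_ofReal {n : ℕ} {α C : ℝ} {f : E → F} (hC : 0 ≤ C)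
    (hsup : ∀ l ≤ n, ∀ x, ‖iteratedFDeriv ℝ l f x‖ ≤ C)
    (hsemi : ∀ x y, ‖iteratedFDeriv ℝ n f x - iteratedFDeriv ℝ n f y‖ ≤ C * ‖x - y‖ ^ α) :
    eHnorm n α f ≤ ENNReal.ofReal C := by
  refine max_le (iSup₂_le fun l x ↦ ?_) (iSup₂_le fun x y ↦ iSup_le fun hxy ↦ ?_)
  · rw [← enorm_eq_nnnorm, ← ofReal_norm]
    exact ENNReal.ofReal_le_ofReal (hsup l (Nat.lt_succ_iff.1 l.2) x)
  · have hpos : 0 < ‖x - y‖ := norm_sub_pos_iff.2 hxy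
    refine ENNReal.div_le_of_le_mul ?_
    rw [edist_dist, dist_eq_norm, ENNReal.ofReal_rpow_of_pos hpos, ← ENNReal.ofReal_mul hC,
      ← enorm_eq_nnnorm, ← ofReal_norm]
    exact ENNReal.ofReal_le_ofReal (hsemi x y)

theorem hnorm_nonneg (n : ℕ) (α : ℝ) (f : E → F) : 0 ≤ hnorm n α f := ENNReal.toReal_nonneg

theorem hnorm_le_of_bounds {n : ℕ} {α C : ℝ} {f : E → F} (hC : 0 ≤ C)
    (hsup : ∀ l ≤ n, ∀ x, ‖iteratedFDeriv ℝ l f x‖ ≤ C)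
    (hsemi : ∀ x y, ‖iteratedFDeriv ℝ n f x - iteratedFDeriv ℝ n f y‖ ≤ C * ‖x - y‖ ^ α) :
    hnorm n α f ≤ C :=
  ENNReal.toReal_le_of_le_ofReal hC (eHnorm_le_ofReal hC hsup hsemi)

theorem MemCb.norm_iteratedFDeriv_le {n : ℕ} {α : ℝ} {f : E → F} (hf : MemCb n α f)
    {l : ℕ} (hl : l ≤ n) (x : E) : ‖iteratedFDeriv ℝ l f x‖ ≤ hnorm n α f := by
  rw [← toReal_enorm]
  refine ENNReal.toReal_mono hf.2.ne (le_max_of_le_left ?_)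
  exact le_iSup₂_of_le (⟨l, Nat.lt_succ_iff.2 hl⟩ : Fin (n + 1)) x le_rfl

theorem MemCb.norm_iteratedFDeriv_sub_le {n : ℕ} {α : ℝ} {f : E → F} (hf : MemCb n α f)
    (x y : E) :
    ‖iteratedFDeriv ℝ n f x - iteratedFDeriv ℝ n f y‖ ≤ hnorm n α f * ‖x - y‖ ^ α := by
  rcases eq_or_ne x y with rfl | hxy
  · simpa using mul_nonneg (hnorm_nonneg n α f) (Real.rpow_nonneg le_rfl α)
  have hpos : 0 < ‖x - y‖ := norm_sub_pos_iff.2 hxy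
  have h : (‖iteratedFDeriv ℝ n f x - iteratedFDeriv ℝ n f y‖₊ : ℝ≥0∞) / edist x y ^ α
      ≤ eHnorm n α f :=
    le_max_of_le_right (le_iSup₂_of_le x y (le_iSup_of_le hxy le_rfl))
  have h' := ENNReal.toReal_mono hf.2.ne h
  rw [ENNReal.toReal_div, ← ENNReal.toReal_rpow, edist_dist, dist_eq_norm,
    ENNReal.toReal_ofReal hpos.le] at h'
  exact (div_le_iff₀ (Real.rpow_pos_of_pos hpos α)).1 h'

/-- Interpolation between a bound and a Lipschitz estimate. -/
theorem min_le_mul_rpow {α N t : ℝ} (hα₀ : 0 < α) (hα₁ : α ≤ 1) (hN : 0 ≤ N) (ht : 0 ≤ t) :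
    min (2 * N) (N * t) ≤ 2 * N * t ^ α := by
  rcases le_total t 1 with h | h
  · have : t ≤ t ^ α := by
      simpa using Real.rpow_le_rpow_of_exponent_ge' ht h hα₀.le hα₁
    refine (min_le_right _ _).trans ?_
    nlinarith [Real.rpow_nonneg ht α, mul_le_mul_of_nonneg_left this hN,
      mul_nonneg hN (Real.rpow_nonneg ht α)]
  · exact (min_le_left _ _).trans
      (le_mul_of_one_le_right (by positivity) (Real.one_le_rpow h hα₀.le))

theorem MemCb.norm_iteratedFDeriv_sub_le_of_le {n : ℕ} {α : ℝ} (hα₀ : 0 < α) (hα₁ : α ≤ 1)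
    {f : E → F} (hf : MemCb n α f) {l : ℕ} (hl : l ≤ n) (x y : E) :
    ‖iteratedFDeriv ℝ l f x - iteratedFDeriv ℝ l f y‖ ≤ 2 * hnorm n α f * ‖x - y‖ ^ α := by
  have hN := hnorm_nonneg n α f
  rcases hl.eq_or_lt with rfl | hlt
  · refine (hf.norm_iteratedFDeriv_sub_le x y).trans ?_
    gcongr
    linarith
  · refine le_trans (le_min ?_ ?_) (min_le_mul_rpow hα₀ hα₁ hN (norm_nonneg _))
    · refine (norm_sub_le _ _).trans ?_
      linarith [hf.norm_iteratedFDeriv_le hl x, hf.norm_iteratedFDeriv_le hl y]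
    · refine convex_univ.norm_image_sub_le_of_norm_fderiv_le (𝕜 := ℝ)
        (fun z _ ↦ ?_) (fun z _ ↦ ?_) (mem_univ y) (mem_univ x)
      · exact (hf.1.differentiable_iteratedFDeriv (by exact_mod_cast hlt)) z
      · rw [norm_fderiv_iteratedFDeriv]
        exact hf.norm_iteratedFDeriv_le hlt z

theorem fderiv_fun_id_eq_const :
    fderiv ℝ (fun x : E ↦ x) = fun _ ↦ ContinuousLinearMap.id ℝ E := by
  ext1 x
  exact fderiv_fun_id

theorem iteratedFDeriv_succ_id_eq (n : ℕ) (x y : E) :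
    iteratedFDeriv ℝ (n + 1) (fun x : E ↦ x) x = iteratedFDeriv ℝ (n + 1) (fun x : E ↦ x) y := by
  simp only [iteratedFDeriv_succ_eq_comp_right, comp_apply, fderiv_fun_id_eq_const]
  cases n with
  | zero => simp [iteratedFDeriv_zero_eq_comp]
  | succ n => simp [iteratedFDeriv_succ_const]

theorem norm_iteratedFDeriv_succ_id_le (n : ℕ) (x : E) :
    ‖iteratedFDeriv ℝ (n + 1) (fun x : E ↦ x) x‖ ≤ 1 := by
  rw [← norm_iteratedFDeriv_fderiv, fderiv_fun_id_eq_const]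
  cases n with
  | zero => simpa using ContinuousLinearMap.norm_id_le
  | succ n => simp [iteratedFDeriv_succ_const]

theorem iteratedFDeriv_id_add {n : ℕ} {f : E → E} (hf : ContDiff ℝ (n : ℕ∞) f) {l : ℕ}
    (hl : l ≤ n) (x : E) :
    iteratedFDeriv ℝ l (fun x ↦ x + f x) x =
      iteratedFDeriv ℝ l (fun x ↦ x) x + iteratedFDeriv ℝ l f x := by
  have := iteratedFDeriv_add (i := l) (f := fun x : E ↦ x) (g := f) contDiff_id
    (hf.of_le (by exact_mod_cast hl))
  exact congrFun this x

theorem MemCb.norm_iteratedFDeriv_id_add_le {n : ℕ} {α : ℝ} {f : E → E} (hf : MemCb n α f)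
    {l : ℕ} (hl₀ : 0 < l) (hl : l ≤ n) (x : E) :
    ‖iteratedFDeriv ℝ l (fun x ↦ x + f x) x‖ ≤ 1 + hnorm n α f := by
  obtain ⟨k, rfl⟩ := Nat.exists_eq_succ_of_ne_zero hl₀.ne'
  rw [iteratedFDeriv_id_add hf.1 hl]
  exact (norm_add_le _ _).trans
    (add_le_add (norm_iteratedFDeriv_succ_id_le k x) (hf.norm_iteratedFDeriv_le hl x))

theorem MemCb.norm_iteratedFDeriv_id_add_sub_le {n : ℕ} {α : ℝ} (hα₀ : 0 < α) (hα₁ : α ≤ 1)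
    {f : E → E} (hf : MemCb n α f) {l : ℕ} (hl₀ : 0 < l) (hl : l ≤ n) (x y : E) :
    ‖iteratedFDeriv ℝ l (fun x ↦ x + f x) x - iteratedFDeriv ℝ l (fun x ↦ x + f x) y‖ ≤
      2 * (1 + hnorm n α f) * ‖x - y‖ ^ α := by
  obtain ⟨k, rfl⟩ := Nat.exists_eq_succ_of_ne_zero hl₀.ne'
  rw [iteratedFDeriv_id_add hf.1 hl, iteratedFDeriv_id_add hf.1 hl,
    iteratedFDeriv_succ_id_eq k x y, add_sub_add_left_eq_sub]
  refine (hf.norm_iteratedFDeriv_sub_le_of_le hα₀ hα₁ hl x y).trans ?_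
  gcongr
  linarith

theorem MemCb.norm_id_add_sub_le {n : ℕ} {α : ℝ} {f : E → E} (hf : MemCb n α f) (hn : 1 ≤ n)
    (x y : E) : ‖(x + f x) - (y + f y)‖ ≤ (1 + hnorm n α f) * ‖x - y‖ := by
  refine convex_univ.norm_image_sub_le_of_norm_fderiv_le (𝕜 := ℝ) (f := fun x ↦ x + f x)
    (fun z _ ↦ ?_) (fun z _ ↦ ?_) (mem_univ y) (mem_univ x)
  · exact (differentiable_id.add (hf.1.differentiable (by exact_mod_cast (by omega)))) z
  · rw [← norm_iteratedFDeriv_one]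
    exact hf.norm_iteratedFDeriv_id_add_le one_pos hn z

theorem iteratedFDeriv_comp_id_add {n : ℕ} {f : E → E} {g : E → G}
    (hf : ContDiff ℝ (n : ℕ∞) f) (hg : ContDiff ℝ (n : ℕ∞) g) {l : ℕ} (hl : l ≤ n) (x : E) :
    iteratedFDeriv ℝ l (fun x ↦ g (x + f x)) x =
      ∑ c : OrderedFinpartition l, c.compAlongOrderedFinpartition
        (iteratedFDeriv ℝ c.length g (x + f x))
        (fun i ↦ iteratedFDeriv ℝ (c.partSize i) (fun x ↦ x + f x) x) :=
  iteratedFDeriv_comp (g := g) (f := fun x ↦ x + f x) hg.contDiffAt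
    (contDiff_id.add hf).contDiffAt (by exact_mod_cast hl)

theorem MemCb.norm_iteratedFDeriv_comp_id_add_le {n : ℕ} {α : ℝ} {f : E → E} {g : E → G}
    (hf : MemCb n α f) (hg : MemCb n α g) {l : ℕ} (hl : l ≤ n) (x : E) :
    ‖iteratedFDeriv ℝ l (fun x ↦ g (x + f x)) x‖ ≤
      Fintype.card (OrderedFinpartition l) * (hnorm n α g * (1 + hnorm n α f) ^ n) := by
  have hF := hnorm_nonneg n α f
  have hN := hnorm_nonneg n α g
  rw [iteratedFDeriv_comp_id_add hf.1 hg.1 hl, ← nsmul_eq_mul]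
  refine norm_sum_le_of_le _ (fun c _ ↦ ?_) |>.trans
    (Finset.sum_le_card_nsmul _ (fun _ ↦ hnorm n α g * (1 + hnorm n α f) ^ n) _ fun _ _ ↦ le_rfl)
  refine (c.norm_compAlongOrderedFinpartition_le _ _).trans ?_
  gcongr
  · exact hg.norm_iteratedFDeriv_le (c.length_le.trans hl) _
  · refine (Finset.prod_le_prod (fun _ _ ↦ norm_nonneg _) fun i _ ↦
      hf.norm_iteratedFDeriv_id_add_le (c.partSize_pos i) ((c.partSize_le i).trans hl) x).trans ?_
    rw [Finset.prod_const, Finset.card_univ, Fintype.card_fin]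
    exact pow_le_pow_right₀ (by linarith) (c.length_le.trans hl)

theorem MemCb.norm_iteratedFDeriv_comp_id_add_sub_le {n : ℕ} {α : ℝ} (hα₀ : 0 < α)
    (hα₁ : α ≤ 1) {f : E → E} {g : E → G} (hf : MemCb n α f) (hg : MemCb n α g) (hn : 1 ≤ n)
    (x y : E) :
    ‖iteratedFDeriv ℝ n (fun x ↦ g (x + f x)) x - iteratedFDeriv ℝ n (fun x ↦ g (x + f x)) y‖ ≤
      Fintype.card (OrderedFinpartition n) *
        ((2 * n + 2) * (hnorm n α g * (1 + hnorm n α f) ^ ((n : ℝ) + α)) * ‖x - y‖ ^ α) := by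
  have hF := hnorm_nonneg n α f
  have hN := hnorm_nonneg n α g
  set N := hnorm n α g
  set B := 1 + hnorm n α f with hB
  have hB₁ : 1 ≤ B := by linarith
  have hB₀ : 0 ≤ B := by linarith
  set τ := ‖x - y‖ ^ α with hτ
  have hτ₀ : 0 ≤ τ := Real.rpow_nonneg (norm_nonneg _) α
  have hBα : 1 ≤ B ^ α := Real.one_le_rpow hB₁ hα₀.le
  have hBnα : B ^ ((n : ℝ) + α) = B ^ n * B ^ α := by
    rw [Real.rpow_add (by linarith), Real.rpow_natCast]
  have hd : ‖(x + f x) - (y + f y)‖ ^ α ≤ B ^ α * τ := by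
    rw [hτ, ← Real.mul_rpow hB₀ (norm_nonneg _)]
    exact Real.rpow_le_rpow (norm_nonneg _) (hf.norm_id_add_sub_le hn x y) hα₀.le
  rw [iteratedFDeriv_comp_id_add hf.1 hg.1 le_rfl, iteratedFDeriv_comp_id_add hf.1 hg.1 le_rfl,
    ← Finset.sum_sub_distrib, ← nsmul_eq_mul]
  refine norm_sum_le_of_le _ (fun c _ ↦ ?_) |>.trans
    (Finset.sum_le_card_nsmul _ (fun _ ↦ (2 * n + 2) * (N * B ^ ((n : ℝ) + α)) * τ) _
      fun _ _ ↦ le_rfl)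
  have hp (z : E) (i : Fin c.length) :
      ‖iteratedFDeriv ℝ (c.partSize i) (fun x ↦ x + f x) z‖ ≤ B :=
    hf.norm_iteratedFDeriv_id_add_le (c.partSize_pos i) (c.partSize_le i) z
  have hpow : (c.length : ℝ) * B ^ (c.length - 1) * B ≤ n * B ^ n := by
    rcases Nat.eq_zero_or_pos c.length with h | h
    · rw [h]
      simp only [Nat.cast_zero, zero_mul]
      positivity
    · rw [mul_assoc, ← pow_succ, Nat.sub_add_cancel h]
      gcongr
      exacts [c.length_le, c.length_le]
  have hprod : ∏ i, ‖iteratedFDeriv ℝ (c.partSize i) (fun x ↦ x + f x) y‖ ≤ B ^ n := by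
    refine (Finset.prod_le_prod (fun _ _ ↦ norm_nonneg _) fun i _ ↦ hp y i).trans ?_
    rw [Finset.prod_const, Finset.card_univ, Fintype.card_fin]
    exact pow_le_pow_right₀ hB₁ c.length_le
  calc _ ≤ _ := c.norm_compAlongOrderedFinpartition_sub_compAlongOrderedFinpartition_le ..
    _ ≤ N * c.length * B ^ (c.length - 1) * (2 * B * τ) + 2 * N * (B ^ α * τ) * B ^ n := by
        gcongr
        · exact hg.norm_iteratedFDeriv_le c.length_le _
        · exact max_le ((pi_norm_le_iff_of_nonneg hB₀).2 (hp x))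
            ((pi_norm_le_iff_of_nonneg hB₀).2 (hp y))
        · exact (pi_norm_le_iff_of_nonneg (by positivity)).2 fun i ↦
            hf.norm_iteratedFDeriv_id_add_sub_le hα₀ hα₁ (c.partSize_pos i) (c.partSize_le i) x y
        · refine (hg.norm_iteratedFDeriv_sub_le_of_le hα₀ hα₁ c.length_le _ _).trans ?_
          gcongr
    _ = 2 * N * τ * (c.length * B ^ (c.length - 1) * B) + 2 * N * (B ^ α * τ) * B ^ n := by ring
    _ ≤ 2 * N * τ * (n * B ^ n * B ^ α) + 2 * N * (B ^ α * τ) * B ^ n := by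
        refine add_le_add_left (mul_le_mul_of_nonneg_left ?_ (by positivity)) _
        exact hpow.trans (le_mul_of_one_le_right (by positivity) hBα)
    _ = (2 * n + 2) * (N * B ^ ((n : ℝ) + α)) * τ := by rw [hBnα]; ring

end Composition

/-- Theorem on composition in Hölder spaces, de la Llave–Obaya 6.2:
for `m ≥ 1` there is `M = M(m) ≥ 1` such that for all `α ∈ (0,1]` and all
`f ∈ C^{m,α}_b(ℝ^d,ℝ^d)`, `g ∈ C^{m,α}_b(ℝ^d,G)` one has
`g ∘ (Id + f) ∈ C^{m,α}_b(ℝ^d,G)` and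
`‖g∘(Id+f)‖_{m,α} ≤ M ‖g‖_{m,α} (1+‖f‖_{m,α})^{m+α}`. -/
theorem stmt0 (m : ℕ) (hm : 1 ≤ m) :
    ∃ M : ℝ, 1 ≤ M ∧
      ∀ (α : ℝ), 0 < α → α ≤ 1 →
      ∀ (d : ℕ) (G : Type) [NormedAddCommGroup G] [NormedSpace ℝ G] [CompleteSpace G],
      ∀ (f : Euc d → Euc d) (g : Euc d → G),
        MemCb m α f → MemCb m α g →
          MemCb m α (fun x => g (x + f x)) ∧
          hnorm m α (fun x => g (x + f x)) ≤
            M * hnorm m α g * (1 + hnorm m α f) ^ ((m : ℝ) + α) := by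
  set K : ℕ := ∑ l ∈ Finset.range (m + 1), Fintype.card (OrderedFinpartition l)
  have hK {l : ℕ} (hl : l ≤ m) : (Fintype.card (OrderedFinpartition l) : ℝ) ≤ K := by
    exact_mod_cast Finset.single_le_sum (f := fun l ↦ Fintype.card (OrderedFinpartition l))
      (fun _ _ ↦ Nat.zero_le _) (Finset.mem_range_succ_iff.2 hl)
  have hK₁ : (1 : ℝ) ≤ K :=
    le_trans (by exact_mod_cast Fintype.card_pos) (hK le_rfl)
  have hm₂ : (1 : ℝ) ≤ 2 * m + 2 := by linarith [(Nat.cast_nonneg m : (0 : ℝ) ≤ m)]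
  refine ⟨K * (2 * m + 2), one_le_mul_of_one_le_of_one_le hK₁ hm₂, ?_⟩
  intro α hα₀ hα₁ d G _ _ _ f g hf hg
  have hF := hnorm_nonneg m α f
  have hN := hnorm_nonneg m α g
  have hC : 0 ≤ K * (2 * m + 2) * hnorm m α g * (1 + hnorm m α f) ^ ((m : ℝ) + α) := by
    positivity
  have hsup (l : ℕ) (hl : l ≤ m) (x : Euc d) :
      ‖iteratedFDeriv ℝ l (fun x ↦ g (x + f x)) x‖ ≤
        K * (2 * m + 2) * hnorm m α g * (1 + hnorm m α f) ^ ((m : ℝ) + α) := by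
    have hpow : (1 + hnorm m α f) ^ m ≤ (1 + hnorm m α f) ^ ((m : ℝ) + α) := by
      rw [← Real.rpow_natCast]
      exact Real.rpow_le_rpow_of_exponent_le (by linarith) (by linarith)
    refine (hf.norm_iteratedFDeriv_comp_id_add_le hg hl x).trans ?_
    rw [← mul_assoc]
    gcongr
    exact (hK hl).trans (le_mul_of_one_le_right (by positivity) hm₂)
  have hsemi (x y : Euc d) :
      ‖iteratedFDeriv ℝ m (fun x ↦ g (x + f x)) x - iteratedFDeriv ℝ m (fun x ↦ g (x + f x)) y‖ ≤
        K * (2 * m + 2) * hnorm m α g * (1 + hnorm m α f) ^ ((m : ℝ) + α) * ‖x - y‖ ^ α := by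
    refine (hf.norm_iteratedFDeriv_comp_id_add_sub_le hα₀ hα₁ hg hm x y).trans ?_
    refine (mul_le_mul_of_nonneg_right (hK le_rfl) (by positivity)).trans_eq ?_
    ring
  exact ⟨⟨hg.1.comp (contDiff_id.add hf.1),
    (eHnorm_le_ofReal hC hsup hsemi).trans_lt ENNReal.ofReal_lt_top⟩,
    hnorm_le_of_bounds hC hsup hsemi⟩
end

section
/- Let m ∈ ℕ with m ≥ 1, 0 < α < β ≤ 1, and let G be a Banach space. Then for all f₀ ∈ C^{m,α}_b(ℝ^d,ℝ^d), g₀ ∈ C^{m,β}_b(ℝ^d,G), and R > 0 there is a constant M = M(m, ‖f₀‖_{m,α}, ‖g₀‖_{m,β}, R) such that for all f₁, f₂ ∈ C^{m,α}_b(ℝ^d,ℝ^d) with ‖fᵢ−f₀‖_{m,α} < R and all g₁, g₂ ∈ C^{m,β}_b(ℝ^d,G) with ‖gᵢ−g₀‖_{m,β} < R one has ‖g₁∘(Id+f₁) − g₂∘(Id+f₂)‖_{m,α} ≤ M (‖g₁−g₂‖_{m,α} + ‖f₁−f₂‖_{m,α})^{β−α}. In particular, composition (g,f) ↦ g∘(Id+f)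 is jointly continuous C^{m,β}_b(ℝ^d,G) × C^{m,α}_b(ℝ^d,ℝ^d) → C^{m,α}_b(ℝ^d,G). -/
open Function Set Filter Topology MeasureTheory
open scoped ENNReal NNReal

namespace HolderComposition

/-- `f` is of class `C^{n,α}_b` with Hölder norm at most `K`. -/
def HolderBound {E F : Type*} [NormedAddCommGroup E] [NormedSpace ℝ E]
    [NormedAddCommGroup F] [NormedSpace ℝ F] (n : ℕ) (α K : ℝ) (f : E → F) : Prop :=
  ContDiff ℝ n f ∧ (∀ l ≤ n, ∀ x, ‖iteratedFDeriv ℝ l f x‖ ≤ K) ∧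
    ∀ x y, ‖iteratedFDeriv ℝ n f x - iteratedFDeriv ℝ n f y‖ ≤ K * ‖x - y‖ ^ α

universe u

variable {E F : Type u} [NormedAddCommGroup E] [NormedSpace ℝ E]
  [NormedAddCommGroup F] [NormedSpace ℝ F] {n : ℕ} {α β K L : ℝ} {f g : E → F}

theorem holderBound_zero_iff :
    HolderBound 0 α K f ↔ Continuous f ∧ (∀ x, ‖f x‖ ≤ K) ∧
      ∀ x y, ‖f x - f y‖ ≤ K * ‖x - y‖ ^ α := by
  have h (x y : E) : ‖iteratedFDeriv ℝ 0 f x - iteratedFDeriv ℝ 0 f y‖ = ‖f x - f y‖ := by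
    simp only [iteratedFDeriv_zero_eq_comp, comp_apply, ← map_sub, LinearIsometryEquiv.norm_map]
  simp [HolderBound, h, contDiff_zero]

theorem holderBound_succ_iff :
    HolderBound (n + 1) α K f ↔
      Differentiable ℝ f ∧ (∀ x, ‖f x‖ ≤ K) ∧ HolderBound n α K (fderiv ℝ f) := by
  have h (x y : E) : ‖iteratedFDeriv ℝ (n + 1) f x - iteratedFDeriv ℝ (n + 1) f y‖ =
      ‖iteratedFDeriv ℝ n (fderiv ℝ f) x - iteratedFDeriv ℝ n (fderiv ℝ f) y‖ := by
    simp only [iteratedFDeriv_succ_eq_comp_right, comp_apply, ← dist_eq_norm]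
    exact LinearIsometryEquiv.dist_map _ _ _
  have hl : (∀ l ≤ n + 1, ∀ x, ‖iteratedFDeriv ℝ l f x‖ ≤ K) ↔
      (∀ x, ‖f x‖ ≤ K) ∧ ∀ l ≤ n, ∀ x, ‖iteratedFDeriv ℝ l (fderiv ℝ f) x‖ ≤ K := by
    refine ⟨fun H => ⟨fun x => ?_, fun l hl x => ?_⟩, fun H l hl x => ?_⟩
    · simpa using H 0 (Nat.zero_le _) x
    · simpa [norm_iteratedFDeriv_fderiv] using H (l + 1) (by omega) x
    · cases l with
      | zero => simpa using H.1 x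
      | succ l => simpa [norm_iteratedFDeriv_fderiv] using H.2 l (by omega) x
  have hc : ContDiff ℝ ((n + 1 : ℕ) : WithTop ℕ∞) f ↔
      Differentiable ℝ f ∧ ContDiff ℝ n (fderiv ℝ f) := by
    push_cast
    rw [contDiff_succ_iff_fderiv]
    simp
  simp only [HolderBound, h, hl, hc]
  tauto

namespace HolderBound

theorem norm_le (h : HolderBound n α K f) (x : E) : ‖f x‖ ≤ K := by
  simpa using h.2.1 0 (Nat.zero_le _) x

theorem nonneg (h : HolderBound n α K f) : 0 ≤ K :=
  (norm_nonneg _).trans (h.norm_le 0)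

theorem mono (h : HolderBound n α K f) (hKL : K ≤ L) : HolderBound n α L f :=
  ⟨h.1, fun l hl x => (h.2.1 l hl x).trans hKL, fun x y => (h.2.2 x y).trans <| by gcongr⟩

theorem const (n : ℕ) (α : ℝ) (c : F) : HolderBound n α ‖c‖ (fun _ : E => c) := by
  refine ⟨contDiff_const, fun l _ x => ?_, fun x y => ?_⟩
  · cases l with
    | zero => simp
    | succ l => simp [iteratedFDeriv_succ_const]
  · cases n with
    | zero =>
      simp only [iteratedFDeriv_zero_eq_comp, comp_apply, sub_self, norm_zero]
      positivity
    | succ n =>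
      simp only [iteratedFDeriv_succ_const, Pi.zero_apply, sub_self, norm_zero]
      positivity

theorem zero (n : ℕ) (α : ℝ) : HolderBound n α 0 (0 : E → F) :=
  norm_zero (E := F) ▸ const (E := E) n α (0 : F)

theorem add (hf : HolderBound n α K f) (hg : HolderBound n α L g) :
    HolderBound n α (K + L) (f + g) := by
  have hadd {l : ℕ} (hl : l ≤ n) (x : E) : iteratedFDeriv ℝ l (f + g) x =
      iteratedFDeriv ℝ l f x + iteratedFDeriv ℝ l g x :=
    iteratedFDeriv_add_apply (hf.1.of_le (mod_cast hl)).contDiffAt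
      (hg.1.of_le (mod_cast hl)).contDiffAt
  refine ⟨hf.1.add hg.1, fun l hl x => ?_, fun x y => ?_⟩
  · rw [hadd hl]
    exact norm_add_le_of_le (hf.2.1 l hl x) (hg.2.1 l hl x)
  · rw [hadd le_rfl, hadd le_rfl, add_sub_add_comm, add_mul]
    exact norm_add_le_of_le (hf.2.2 x y) (hg.2.2 x y)

theorem neg (hf : HolderBound n α K f) : HolderBound n α K (-f) := by
  refine ⟨hf.1.neg, fun l hl x => ?_, fun x y => ?_⟩
  · simpa [iteratedFDeriv_neg_apply] using hf.2.1 l hl x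
  · rw [iteratedFDeriv_neg_apply, iteratedFDeriv_neg_apply, ← neg_sub', norm_neg]
    exact hf.2.2 x y

theorem sub (hf : HolderBound n α K f) (hg : HolderBound n α L g) :
    HolderBound n α (K + L) (f - g) := by
  simpa [sub_eq_add_neg] using hf.add hg.neg

theorem of_exponent_le (hα : 0 ≤ α) (hαβ : α ≤ β) (h : HolderBound n β K f) :
    HolderBound n α (2 * K) f := by
  have hK := h.nonneg
  refine ⟨h.1, fun l hl x => (h.2.1 l hl x).trans (by linarith), fun x y => ?_⟩
  rcases le_total ‖x - y‖ 1 with hr | hr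
  · rcases (norm_nonneg (x - y)).eq_or_lt with h0 | h0
    · rw [eq_comm, norm_eq_zero, sub_eq_zero] at h0
      subst h0
      simp only [sub_self, norm_zero]
      positivity
    calc _ ≤ K * ‖x - y‖ ^ β := h.2.2 x y
      _ ≤ (2 * K) * ‖x - y‖ ^ α :=
        mul_le_mul (by linarith) (Real.rpow_le_rpow_of_exponent_ge h0 hr hαβ) (by positivity)
          (by positivity)
  · calc _ ≤ K + K := norm_sub_le_of_le (h.2.1 n le_rfl x) (h.2.1 n le_rfl y)
      _ = (2 * K) * 1 := by ring
      _ ≤ (2 * K) * ‖x - y‖ ^ α := by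
        gcongr
        exact Real.one_le_rpow hr hα

theorem norm_image_sub_le (h : HolderBound (n + 1) α K f) (x y : E) :
    ‖f x - f y‖ ≤ K * ‖x - y‖ := by
  rw [holderBound_succ_iff] at h
  exact convex_univ.norm_image_sub_le_of_norm_fderiv_le (𝕜 := ℝ) (fun z _ => h.1 z)
    (fun z _ => h.2.2.norm_le z) (mem_univ y) (mem_univ x)

theorem of_succ (hα : 0 ≤ α) (hα1 : α ≤ 1) (h : HolderBound (n + 1) α K f) :
    HolderBound n α (2 * K) f := by
  induction n generalizing F with
  | zero =>
    refine of_exponent_le hα hα1 (holderBound_zero_iff.2 ⟨h.1.continuous, h.norm_le, fun x y => ?_⟩)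
    simpa using h.norm_image_sub_le x y
  | succ n ih =>
    have hK := h.nonneg
    rw [holderBound_succ_iff] at h ⊢
    exact ⟨h.1, fun x => (h.2.1 x).trans (by linarith), ih h.2.2⟩

theorem bilinear {F₁ F₂ : Type u} [NormedAddCommGroup F₁] [NormedSpace ℝ F₁]
    [NormedAddCommGroup F₂] [NormedSpace ℝ F₂] (hα : 0 ≤ α) (hα1 : α ≤ 1)
    (B : F₁ →L[ℝ] F₂ →L[ℝ] F) {v : E → F₁} {w : E → F₂}
    (hv : HolderBound n α K v) (hw : HolderBound n α L w) :
    HolderBound n α (2 * 4 ^ n * ‖B‖ * K * L) (fun x => B (v x) (w x)) := by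
  have hK := hv.nonneg
  have hL := hw.nonneg
  have hB {a : F₁} {b : F₂} {s t : ℝ} (ha : ‖a‖ ≤ s) (hb : ‖b‖ ≤ t) : ‖B a b‖ ≤ ‖B‖ * s * t :=
    B.le_of_opNorm₂_le_of_le le_rfl ha hb
  induction n generalizing F F₁ F₂ K L with
  | zero =>
    rw [holderBound_zero_iff] at hv hw ⊢
    refine ⟨(B.continuous.comp hv.1).clm_apply hw.1, fun x => ?_, fun x y => ?_⟩
    · refine (hB (hv.2.1 x) (hw.2.1 x)).trans ?_
      have : 0 ≤ ‖B‖ * K * L := by positivity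
      linarith
    · have : B (v x) (w x) - B (v y) (w y) = B (v x - v y) (w x) + B (v y) (w x - w y) := by
        simp
      rw [this]
      refine (norm_add_le_of_le (hB (hv.2.2 x y) (hw.2.1 x))
        (hB (hv.2.1 y) (hw.2.2 x y))).trans (le_of_eq ?_)
      ring
  | succ n ih =>
    have hv' := hv.of_succ hα hα1
    have hw' := hw.of_succ hα hα1
    rw [holderBound_succ_iff] at hv hw ⊢
    have hd (x : E) := B.hasFDerivAt_of_bilinear (hv.1 x).hasFDerivAt (hw.1 x).hasFDerivAt
    refine ⟨fun x => (hd x).differentiableAt, fun x => ?_, ?_⟩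
    · refine (hB (hv.2.1 x) (hw.2.1 x)).trans ?_
      have h1 : (1 : ℝ) ≤ 2 * 4 ^ (n + 1) := by
        have := one_le_pow₀ (n := n + 1) (show (1 : ℝ) ≤ 4 by norm_num)
        linarith
      have : 0 ≤ ‖B‖ * K * L := by positivity
      nlinarith
    · rw [show fderiv ℝ (fun x => B (v x) (w x)) =
        (fun x => B.precompR E (v x) (fderiv ℝ w x)) +
          fun x => B.precompL E (fderiv ℝ v x) (w x) from funext fun x => (hd x).fderiv]
      refine ((ih (B.precompR E) hv' hw.2.2 hv'.nonneg hL
          ((B.precompR E).le_of_opNorm₂_le_of_le le_rfl)).add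
        (ih (B.precompL E) hv.2.2 hw' hK hw'.nonneg
          ((B.precompL E).le_of_opNorm₂_le_of_le le_rfl))).mono ?_
      calc _ ≤ 2 * 4 ^ n * ‖B‖ * (2 * K) * L + 2 * 4 ^ n * ‖B‖ * K * (2 * L) := by
            gcongr
            · exact B.norm_precompR_le E
            · exact B.norm_precompL_le E
        _ = _ := by ring

end HolderBound

theorem le_mul_rpow {t K s : ℝ} (ht : 0 ≤ t) (htK : t ≤ K) (hK : 1 ≤ K) {p : ℝ} (hs : 0 < s)
    (hp : s ≤ p) (hp1 : p ≤ s + 1) : t ^ p ≤ K * t ^ s := by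
  calc t ^ p = t ^ (p - s) * t ^ s := by
        rw [← Real.rpow_add_of_nonneg ht (by linarith) hs.le]
        congr 1
        ring
    _ ≤ K * t ^ s := by
      gcongr
      calc t ^ (p - s) ≤ K ^ (p - s) := Real.rpow_le_rpow ht htK (by linarith)
        _ ≤ K ^ (1 : ℝ) := Real.rpow_le_rpow_of_exponent_le hK (by linarith)
        _ = K := Real.rpow_one K

theorem HolderBound.comp_sub_comp_zero (hα : 0 < α) (hαβ : α < β) (hβ : β ≤ 1) {δ : ℝ}
    (hK : 1 ≤ K) (hδ : 0 ≤ δ) (hδK : δ ≤ K) {φ₁ φ₂ : E → E} {g₁ g₂ : E → F}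
    (hφ₁ : ∀ x y, ‖φ₁ x - φ₁ y‖ ≤ K * ‖x - y‖) (hφ₂ : ∀ x y, ‖φ₂ x - φ₂ y‖ ≤ K * ‖x - y‖)
    (hφ : ∀ x, ‖φ₁ x - φ₂ x‖ ≤ δ) (hg₂ : HolderBound 0 β K g₂)
    (hg : HolderBound 0 α δ (g₁ - g₂)) :
    HolderBound 0 α (4 * K ^ 2 * δ ^ (β - α)) (fun x => g₁ (φ₁ x) - g₂ (φ₂ x)) := by
  rw [holderBound_zero_iff] at hg₂ hg ⊢
  obtain ⟨hcg₂, -, hg₂⟩ := hg₂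
  obtain ⟨hcg, hgb, hg⟩ := hg
  have hcφ {φ : E → E} (h : ∀ x y, ‖φ x - φ y‖ ≤ K * ‖x - y‖) : Continuous φ :=
    (LipschitzWith.of_dist_le_mul (K := ⟨K, by linarith⟩) fun x y => by
      rw [dist_eq_norm, dist_eq_norm]; exact h x y).continuous
  have hγ : 0 < β - α := by linarith
  have hδγ : 0 ≤ δ ^ (β - α) := by positivity
  have hδ1 : δ ≤ K * δ ^ (β - α) := by
    simpa using le_mul_rpow hδ hδK hK hγ (p := 1) (by linarith) (by linarith)
  have hδβ : δ ^ β ≤ K * δ ^ (β - α) := le_mul_rpow hδ hδK hK hγ (by linarith) (by linarith)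
  have hsplit (x : E) : g₁ (φ₁ x) - g₂ (φ₂ x) =
      (g₁ - g₂) (φ₁ x) + (g₂ (φ₁ x) - g₂ (φ₂ x)) := by simp
  have hmid (x : E) : ‖g₂ (φ₁ x) - g₂ (φ₂ x)‖ ≤ K * δ ^ β :=
    (hg₂ _ _).trans (by gcongr; exacts [by linarith, hφ x])
  have hpow {s : ℝ} (hs : 0 ≤ s) (hs1 : s ≤ 1) {φ : E → E}
      (h : ∀ x y, ‖φ x - φ y‖ ≤ K * ‖x - y‖) (x y : E) :
      ‖φ x - φ y‖ ^ s ≤ K * ‖x - y‖ ^ s := by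
    calc ‖φ x - φ y‖ ^ s ≤ (K * ‖x - y‖) ^ s := by gcongr; exact h x y
      _ = K ^ s * ‖x - y‖ ^ s := Real.mul_rpow (by linarith) (norm_nonneg _)
      _ ≤ K * ‖x - y‖ ^ s := by
        gcongr
        simpa using Real.rpow_le_rpow_of_exponent_le hK hs1
  have hKK : K ≤ K ^ 2 := by nlinarith
  refine ⟨?_, fun x => ?_, fun x y => ?_⟩
  · simp only [hsplit]
    exact (hcg.comp (hcφ hφ₁)).add ((hcg₂.comp (hcφ hφ₁)).sub (hcg₂.comp (hcφ hφ₂)))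
  · rw [hsplit]
    calc _ ≤ δ + K * δ ^ β := norm_add_le_of_le (hgb _) (hmid x)
      _ ≤ K * δ ^ (β - α) + K * (K * δ ^ (β - α)) := by gcongr
      _ = (K + K ^ 2) * δ ^ (β - α) := by ring
      _ ≤ _ := by gcongr; nlinarith
  · set r := ‖x - y‖ with hr
    have hr0 : 0 ≤ r := norm_nonneg _
    have h1 : ‖(g₁ - g₂) (φ₁ x) - (g₁ - g₂) (φ₁ y)‖ ≤ K ^ 2 * δ ^ (β - α) * r ^ α := by
      calc _ ≤ δ * ‖φ₁ x - φ₁ y‖ ^ α := hg _ _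
        _ ≤ (K * δ ^ (β - α)) * (K * r ^ α) := by
          gcongr
          exact hpow hα.le (by linarith) hφ₁ x y
        _ = _ := by ring
    have h2 : ‖(g₂ (φ₁ x) - g₂ (φ₂ x)) - (g₂ (φ₁ y) - g₂ (φ₂ y))‖ ≤
        2 * K ^ 2 * δ ^ (β - α) * r ^ α := by
      have hadd {t : ℝ} (ht : 0 ≤ t) : t ^ β = t ^ (β - α) * t ^ α := by
        rw [← Real.rpow_add_of_nonneg ht hγ.le hα.le]
        congr 1
        ring
      rcases le_total r δ with hrδ | hrδ
      · rw [sub_sub_sub_comm]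
        calc _ ≤ K * (K * r ^ β) + K * (K * r ^ β) := by
              refine norm_sub_le_of_le ((hg₂ _ _).trans ?_) ((hg₂ _ _).trans ?_) <;> gcongr
              · exact hpow (by linarith) hβ hφ₁ x y
              · exact hpow (by linarith) hβ hφ₂ x y
          _ = 2 * K ^ 2 * (r ^ (β - α) * r ^ α) := by rw [hadd hr0]; ring
          _ ≤ 2 * K ^ 2 * (δ ^ (β - α) * r ^ α) := by gcongr
          _ = _ := by ring
      · calc _ ≤ K * δ ^ β + K * δ ^ β := norm_sub_le_of_le (hmid x) (hmid y)
          _ = 2 * K * (δ ^ (β - α) * δ ^ α) := by rw [hadd hδ]; ring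
          _ ≤ 2 * K ^ 2 * (δ ^ (β - α) * r ^ α) := by gcongr
          _ = _ := by ring
    rw [hsplit, hsplit, add_sub_add_comm]
    refine (norm_add_le_of_le h1 h2).trans ?_
    have : 0 ≤ K ^ 2 * δ ^ (β - α) * r ^ α := by positivity
    linarith

theorem exists_holderBound_comp_sub_comp (E : Type u) [NormedAddCommGroup E] [NormedSpace ℝ E]
    (hα : 0 < α) (hαβ : α < β) (hβ : β ≤ 1) (n : ℕ) (K : ℝ) (hK : 1 ≤ K) :
    ∃ C : ℝ, 0 ≤ C ∧ ∀ (F : Type u) [NormedAddCommGroup F] [NormedSpace ℝ F] (δ : ℝ)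
      (f₁ f₂ : E → E) (g₁ g₂ : E → F), δ ≤ K →
      HolderBound n α K f₁ → HolderBound n α K f₂ →
      (∀ x y, ‖f₁ x - f₁ y‖ ≤ K * ‖x - y‖) → (∀ x y, ‖f₂ x - f₂ y‖ ≤ K * ‖x - y‖) →
      HolderBound n β K g₁ → HolderBound n β K g₂ →
      HolderBound n α δ (f₁ - f₂) → HolderBound n α δ (g₁ - g₂) →
      HolderBound n α (C * δ ^ (β - α)) (fun x => g₁ (x + f₁ x) - g₂ (x + f₂ x)) := by
  induction n generalizing K with
  | zero =>
    refine ⟨4 * (2 * K) ^ 2, by positivity, ?_⟩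
    intro F _ _ δ f₁ f₂ g₁ g₂ hδK _ _ hl₁ hl₂ _ hg₂ hf hg
    have hlip {f : E → E} (h : ∀ x y, ‖f x - f y‖ ≤ K * ‖x - y‖) (x y : E) :
        ‖x + f x - (y + f y)‖ ≤ 2 * K * ‖x - y‖ := by
      rw [add_sub_add_comm]
      refine (norm_add_le_of_le le_rfl (h x y)).trans ?_
      nlinarith [norm_nonneg (x - y)]
    exact HolderBound.comp_sub_comp_zero hα hαβ hβ (by linarith) hf.nonneg (by linarith)
      (hlip hl₁) (hlip hl₂) (fun x => by simpa using hf.norm_le x) (hg₂.mono (by linarith)) hg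
  | succ n ih =>
    obtain ⟨C, hC, ih⟩ := ih (2 * K) (by linarith)
    have hα1 : α ≤ 1 := by linarith
    set γ := β - α with hγ
    have hγ0 : 0 < γ := by linarith
    set D := 2 * 4 ^ n * 1 * (C * 2 ^ γ) * (1 + K) + 2 * 4 ^ n * 1 * (C * (2 * K) ^ γ) * K with hD
    have hK0 : 0 ≤ K := by linarith
    refine ⟨max (C * 2 ^ γ) D, by positivity, ?_⟩
    intro F _ _ δ f₁ f₂ g₁ g₂ hδK hf₁ hf₂ hl₁ hl₂ hg₁ hg₂ hf hg
    have hδ := hf.nonneg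
    have lip2 {f : E → E} (h : ∀ x y, ‖f x - f y‖ ≤ K * ‖x - y‖) (x y : E) :
        ‖f x - f y‖ ≤ 2 * K * ‖x - y‖ :=
      (h x y).trans (by gcongr; linarith)
    have hl₁' := lip2 hl₁
    have hl₂' := lip2 hl₂
    have hf₁' := hf₁.of_succ hα.le hα1
    have hf₂' := hf₂.of_succ hα.le hα1
    have hf' := hf.of_succ hα.le hα1
    have hpow2 : C * (2 * δ) ^ γ = C * 2 ^ γ * δ ^ γ := by
      rw [Real.mul_rpow (by norm_num) hδ, mul_assoc]
    have hsup := ih F (2 * δ) f₁ f₂ g₁ g₂ (by linarith) hf₁' hf₂' hl₁' hl₂'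
      (hg₁.of_succ (by linarith) hβ) (hg₂.of_succ (by linarith) hβ) hf' (hg.of_succ hα.le hα1)
    rw [hpow2] at hsup
    rw [holderBound_succ_iff] at hf₁ hf₂ hg₁ hg₂ hf hg ⊢
    have hdf : fderiv ℝ (f₁ - f₂) = fderiv ℝ f₁ - fderiv ℝ f₂ :=
      funext fun x => fderiv_sub (hf₁.1 x) (hf₂.1 x)
    have hdg : fderiv ℝ (g₁ - g₂) = fderiv ℝ g₁ - fderiv ℝ g₂ :=
      funext fun x => fderiv_sub (hg₁.1 x) (hg₂.1 x)
    rw [hdf] at hf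
    rw [hdg] at hg
    have hA := ih (E →L[ℝ] F) (2 * δ) f₁ f₂ (fderiv ℝ g₁) (fderiv ℝ g₂) (by linarith) hf₁' hf₂'
      hl₁' hl₂' (hg₁.2.2.mono (by linarith)) (hg₂.2.2.mono (by linarith)) hf'
      (hg.2.2.mono (by linarith))
    rw [hpow2] at hA
    have hB := ih (E →L[ℝ] F) (2 * K) f₂ f₂ (fderiv ℝ g₂) 0 le_rfl hf₂' hf₂'
      hl₂' hl₂' (hg₂.2.2.mono (by linarith)) ((HolderBound.zero n β).mono (by linarith))
      (by simpa using (HolderBound.zero n α).mono (by linarith))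
      (by simpa using hg₂.2.2.of_exponent_le hα.le hαβ.le)
    simp only [Pi.zero_apply, sub_zero] at hB
    have hid : HolderBound n α (1 + K) (fun x => ContinuousLinearMap.id ℝ E + fderiv ℝ f₁ x) :=
      (((HolderBound.const n α (ContinuousLinearMap.id ℝ E)).mono
        ContinuousLinearMap.norm_id_le).add hf₁.2.2)
    have hd {f : E → E} {g : E → F} (hf : Differentiable ℝ f) (hg : Differentiable ℝ g) (x : E) :
        HasFDerivAt (fun x => g (x + f x))
          ((fderiv ℝ g (x + f x)).comp (ContinuousLinearMap.id ℝ E + fderiv ℝ f x)) x :=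
      (hg (x + f x)).hasFDerivAt.comp x ((hasFDerivAt_id x).add (hf x).hasFDerivAt)
    have hd' (x : E) := (hd hf₁.1 hg₁.1 x).sub (hd hf₂.1 hg₂.1 x)
    have hδ1 : δ ≤ K * δ ^ γ := by
      simpa using le_mul_rpow hδ hδK hK hγ0 (p := 1) (by linarith) (by linarith)
    refine ⟨fun x => (hd' x).differentiableAt, fun x => (hsup.norm_le x).trans ?_, ?_⟩
    · gcongr
      exact le_max_left _ _
    · have hsplit : fderiv ℝ (fun x => g₁ (x + f₁ x) - g₂ (x + f₂ x)) =
          (fun x => ContinuousLinearMap.compL ℝ E E F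
            (fderiv ℝ g₁ (x + f₁ x) - fderiv ℝ g₂ (x + f₂ x))
            (ContinuousLinearMap.id ℝ E + fderiv ℝ f₁ x)) +
          fun x => ContinuousLinearMap.compL ℝ E E F (fderiv ℝ g₂ (x + f₂ x))
            ((fderiv ℝ f₁ - fderiv ℝ f₂) x) := by
        funext x
        refine (hd' x).fderiv.trans ?_
        ext z
        simp
        abel
      rw [hsplit]
      refine ((hA.bilinear hα.le hα1 _ hid).add (hB.bilinear hα.le hα1 _ hf.2.2)).mono ?_
      calc _ ≤ 2 * 4 ^ n * 1 * (C * 2 ^ γ * δ ^ γ) * (1 + K) +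
            2 * 4 ^ n * 1 * (C * (2 * K) ^ γ) * (K * δ ^ γ) := by
            gcongr <;> exact ContinuousLinearMap.norm_compL_le ℝ E E F
        _ = D * δ ^ γ := by rw [hD]; ring
        _ ≤ _ := by gcongr; exact le_max_right _ _

theorem holderBound_iff (hα : 0 < α) (hK : 0 ≤ K) :
    HolderBound n α K f ↔ ContDiff ℝ n f ∧ eHnorm n α f ≤ ENNReal.ofReal K := by
  have h1 : eCnb n f ≤ ENNReal.ofReal K ↔ ∀ l ≤ n, ∀ x, ‖iteratedFDeriv ℝ l f x‖ ≤ K := by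
    simp only [eCnb, iSup_le_iff, Fin.forall_iff, Nat.lt_succ_iff, ← enorm_eq_nnnorm,
      ← ofReal_norm, ENNReal.ofReal_le_ofReal_iff hK]
  have h2 : eHsemi n α f ≤ ENNReal.ofReal K ↔
      ∀ x y, ‖iteratedFDeriv ℝ n f x - iteratedFDeriv ℝ n f y‖ ≤ K * ‖x - y‖ ^ α := by
    simp only [eHsemi, iSup_le_iff]
    refine forall₂_congr fun x y => ?_
    rcases eq_or_ne x y with rfl | hxy
    · simp [Real.zero_rpow hα.ne']
    have hr : 0 < ‖x - y‖ := norm_pos_iff.2 (sub_ne_zero.2 hxy)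
    simp only [ne_eq, hxy, not_false_eq_true, forall_const]
    rw [edist_dist, dist_eq_norm, ENNReal.ofReal_rpow_of_pos hr,
      ENNReal.div_le_iff (by simpa using Real.rpow_pos_of_pos hr α) ENNReal.ofReal_ne_top,
      ← ENNReal.ofReal_mul hK, ← enorm_eq_nnnorm, ← ofReal_norm,
      ENNReal.ofReal_le_ofReal_iff (by positivity)]
  rw [HolderBound, eHnorm, max_le_iff, h1, h2]

theorem HolderBound.memCb (hα : 0 < α) (h : HolderBound n α K f) : MemCb n α f :=
  let h' := (holderBound_iff hα h.nonneg).1 h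
  ⟨h'.1, h'.2.trans_lt ENNReal.ofReal_lt_top⟩

theorem HolderBound.hnorm_le (hα : 0 < α) (h : HolderBound n α K f) : hnorm n α f ≤ K :=
  ENNReal.toReal_le_of_le_ofReal h.nonneg ((holderBound_iff hα h.nonneg).1 h).2

theorem holderBound_hnorm (hα : 0 < α) (h : MemCb n α f) : HolderBound n α (hnorm n α f) f :=
  (holderBound_iff hα ENNReal.toReal_nonneg).2 ⟨h.1, (ENNReal.ofReal_toReal h.2.ne).ge⟩

theorem holderBound_hnorm_sub (hα : 0 < α) (hf : MemCb n α f) (hg : MemCb n α g) :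
    HolderBound n α (hnorm n α (f - g)) (f - g) :=
  holderBound_hnorm hα (((holderBound_hnorm hα hf).sub (holderBound_hnorm hα hg)).memCb hα)

theorem exists_hnorm_comp_sub_comp_le (hn : 1 ≤ n) (hα : 0 < α) (hαβ : α < β) (hβ : β ≤ 1)
    {f₀ : E → E} (hf₀ : MemCb n α f₀) {g₀ : E → F} (hg₀ : MemCb n β g₀) {R : ℝ} (hR : 0 < R) :
    ∃ M : ℝ, ∀ f₁ f₂ : E → E, ∀ g₁ g₂ : E → F,
      MemCb n α f₁ → MemCb n α f₂ → MemCb n β g₁ → MemCb n β g₂ →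
      hnorm n α (f₁ - f₀) < R → hnorm n α (f₂ - f₀) < R →
      hnorm n β (g₁ - g₀) < R → hnorm n β (g₂ - g₀) < R →
      hnorm n α (fun x => g₁ (x + f₁ x) - g₂ (x + f₂ x)) ≤
        M * (hnorm n α (g₁ - g₂) + hnorm n α (f₁ - f₂)) ^ (β - α) := by
  have hβ0 : 0 < β := hα.trans hαβ
  have hf₀' := holderBound_hnorm hα hf₀
  have hg₀' := holderBound_hnorm hβ0 hg₀
  have hf₀n := hf₀'.nonneg
  have hg₀n := hg₀'.nonneg
  obtain ⟨C, -, hC⟩ := exists_holderBound_comp_sub_comp E hα hαβ hβ n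
    (1 + 6 * R + hnorm n α f₀ + hnorm n β g₀) (by linarith)
  refine ⟨C, fun f₁ f₂ g₁ g₂ hf₁ hf₂ hg₁ hg₂ hfR₁ hfR₂ hgR₁ hgR₂ => ?_⟩
  have hball {G : Type u} [NormedAddCommGroup G] [NormedSpace ℝ G] {s : ℝ} (hs : 0 < s)
      {h h₀ : E → G} (hh : MemCb n s h) (hh₀ : MemCb n s h₀) (hR : hnorm n s (h - h₀) < R) :
      HolderBound n s (R + hnorm n s h₀) h := by
    simpa using ((holderBound_hnorm_sub hs hh hh₀).mono hR.le).add (holderBound_hnorm hs hh₀)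
  have hdiff {G : Type u} [NormedAddCommGroup G] [NormedSpace ℝ G] {s : ℝ} (hs : 0 < s)
      {h h' h₀ : E → G} (hh : MemCb n s h) (hh' : MemCb n s h') (hh₀ : MemCb n s h₀)
      (hR : hnorm n s (h - h₀) < R) (hR' : hnorm n s (h' - h₀) < R) :
      HolderBound n s (R + R) (h - h') := by
    simpa using ((holderBound_hnorm_sub hs hh hh₀).mono hR.le).sub
      ((holderBound_hnorm_sub hs hh' hh₀).mono hR'.le)
  have hf₁b := (hball hα hf₁ hf₀ hfR₁).mono (L := 1 + 6 * R + hnorm n α f₀ + hnorm n β g₀)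
    (by linarith)
  have hf₂b := (hball hα hf₂ hf₀ hfR₂).mono (L := 1 + 6 * R + hnorm n α f₀ + hnorm n β g₀)
    (by linarith)
  have hlip {f : E → E} {K : ℝ} (h : HolderBound n α K f) (x y : E) :
      ‖f x - f y‖ ≤ K * ‖x - y‖ := by
    rw [← Nat.sub_add_cancel hn] at h
    exact h.norm_image_sub_le x y
  have hf := hdiff hα hf₁ hf₂ hf₀ hfR₁ hfR₂
  have hg := (hdiff hβ0 hg₁ hg₂ hg₀ hgR₁ hgR₂).of_exponent_le hα.le hαβ.le
  have hfδ := holderBound_hnorm_sub hα hf₁ hf₂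
  have hgδ := holderBound_hnorm hα (hg.memCb hα)
  have hfn := hf.hnorm_le hα
  have hgn := hg.hnorm_le hα
  exact (hC F _ f₁ f₂ g₁ g₂ (by linarith) hf₁b hf₂b (hlip hf₁b) (hlip hf₂b)
    ((hball hβ0 hg₁ hg₀ hgR₁).mono (by linarith)) ((hball hβ0 hg₂ hg₀ hgR₂).mono (by linarith))
    (hfδ.mono (by linarith [hgδ.nonneg])) (hgδ.mono (by linarith [hfδ.nonneg]))).hnorm_le hα

theorem exists_hnorm_comp_sub_comp_lt (hn : 1 ≤ n) (hα : 0 < α) (hαβ : α < β) (hβ : β ≤ 1)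
    {f₀ : E → E} (hf₀ : MemCb n α f₀) {g₀ : E → F} (hg₀ : MemCb n β g₀) {ε : ℝ} (hε : 0 < ε) :
    ∃ δ > (0 : ℝ), ∀ f : E → E, ∀ g : E → F, MemCb n α f → MemCb n β g →
      hnorm n α (f - f₀) < δ → hnorm n β (g - g₀) < δ →
      hnorm n α (fun x => g (x + f x) - g₀ (x + f₀ x)) < ε := by
  have hβ0 : 0 < β := hα.trans hαβ
  obtain ⟨M, hM⟩ := exists_hnorm_comp_sub_comp_le hn hα hαβ hβ hf₀ hg₀ one_pos
  have hγ : 0 < β - α := sub_pos.2 hαβ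
  have ht : Tendsto (fun t : ℝ => |M| * (3 * t) ^ (β - α)) (𝓝[>] 0) (𝓝 0) := by
    have : Continuous fun t : ℝ => |M| * (3 * t) ^ (β - α) :=
      continuous_const.mul ((continuous_const.mul continuous_id).rpow_const fun _ => .inr hγ.le)
    simpa [Real.zero_rpow hγ.ne'] using (this.tendsto 0).mono_left nhdsWithin_le_nhds
  obtain ⟨δ, hδε, hδ0, hδ1⟩ := ((ht.eventually_lt_const hε).and
    (Ioo_mem_nhdsGT (zero_lt_one' ℝ))).exists
  refine ⟨δ, hδ0, fun f g hf hg hfδ hgδ => ?_⟩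
  have hz {G : Type u} [NormedAddCommGroup G] [NormedSpace ℝ G] {s : ℝ} (hs : 0 < s)
      (h : E → G) : hnorm n s (h - h) < 1 := by
    rw [sub_self]
    exact ((HolderBound.zero n s).hnorm_le hs).trans_lt one_pos
  have hgα := ((holderBound_hnorm_sub hβ0 hg hg₀).of_exponent_le hα.le hαβ.le).hnorm_le hα
  have hsum : 0 ≤ hnorm n α (g - g₀) + hnorm n α (f - f₀) :=
    add_nonneg ENNReal.toReal_nonneg ENNReal.toReal_nonneg
  calc _ ≤ M * (hnorm n α (g - g₀) + hnorm n α (f - f₀)) ^ (β - α) :=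
        hM f f₀ g g₀ hf hf₀ hg hg₀ (hfδ.trans hδ1) (hz hα f₀) (hgδ.trans hδ1) (hz hβ0 g₀)
    _ ≤ |M| * (3 * δ) ^ (β - α) := by
      gcongr
      · exact le_abs_self M
      · linarith
    _ < ε := hδε

end HolderComposition

/-- joint continuity of composition:
for `0 < α < β ≤ 1` and balls around `f₀ ∈ C^{m,α}_b(ℝ^d,ℝ^d)`,
`g₀ ∈ C^{m,β}_b(ℝ^d,G)`, the estimate
`‖g₁∘(Id+f₁) − g₂∘(Id+f₂)‖_{m,α} ≤ M (‖g₁−g₂‖_{m,α} + ‖f₁−f₂‖_{m,α})^{β−α}` holds;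
in particular composition `(g,f) ↦ g∘(Id+f)` is jointly continuous. -/
theorem stmt2 (d m : ℕ) (hm : 1 ≤ m) (α β : ℝ) (hα : 0 < α) (hαβ : α < β) (hβ : β ≤ 1)
    (G : Type) [NormedAddCommGroup G] [NormedSpace ℝ G] [CompleteSpace G] :
    (∀ f₀ : Euc d → Euc d, MemCb m α f₀ → ∀ g₀ : Euc d → G, MemCb m β g₀ → ∀ R > (0 : ℝ),
      ∃ M : ℝ, ∀ f₁ f₂ : Euc d → Euc d, ∀ g₁ g₂ : Euc d → G,
        MemCb m α f₁ → MemCb m α f₂ → MemCb m β g₁ → MemCb m β g₂ →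
        hnorm m α (f₁ - f₀) < R → hnorm m α (f₂ - f₀) < R →
        hnorm m β (g₁ - g₀) < R → hnorm m β (g₂ - g₀) < R →
        hnorm m α (fun x => g₁ (x + f₁ x) - g₂ (x + f₂ x)) ≤
          M * (hnorm m α (g₁ - g₂) + hnorm m α (f₁ - f₂)) ^ (β - α)) ∧
    (∀ f₀ : Euc d → Euc d, MemCb m α f₀ → ∀ g₀ : Euc d → G, MemCb m β g₀ →
      ∀ ε > (0 : ℝ), ∃ δ > (0 : ℝ),
        ∀ f : Euc d → Euc d, ∀ g : Euc d → G, MemCb m α f → MemCb m β g →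
          hnorm m α (f - f₀) < δ → hnorm m β (g - g₀) < δ →
          hnorm m α (fun x => g (x + f x) - g₀ (x + f₀ x)) < ε) := by
  exact ⟨fun f₀ hf₀ g₀ hg₀ R hR =>
      HolderComposition.exists_hnorm_comp_sub_comp_le hm hα hαβ hβ hf₀ hg₀ hR,
    fun f₀ hf₀ g₀ hg₀ ε hε =>
      HolderComposition.exists_hnorm_comp_sub_comp_lt hm hα hαβ hβ hf₀ hg₀ hε⟩
end

section
/- Let m ∈ ℕ with m ≥ 1 and 0 < α < β ≤ 1, and let G be a Banach space. If g ∈ C^{m+1,β}_b(ℝ^d,G), then the left translation g_⋆ : C^{m,α}_b(ℝ^d,ℝ^d) → C^{m,α}_b(ℝ^d,G), g_⋆(f) := g∘(Id+f), is continuously Fréchet differentiable, with derivative given by d(g_⋆)(ψ)(φ) = (x ↦ dg(x+ψ(x))·φ(x)). -/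
open Function Set Filter Topology MeasureTheory
open scoped ENNReal NNReal

section HolderBound

set_option maxSynthPendingDepth 3

universe u

variable {E F G H : Type u} [NormedAddCommGroup E] [NormedSpace ℝ E]
  [NormedAddCommGroup F] [NormedSpace ℝ F] [NormedAddCommGroup G] [NormedSpace ℝ G]
  [NormedAddCommGroup H] [NormedSpace ℝ H]

/-- `HolderBound α C m f` says that `f` is `m` times differentiable, with all derivatives of order
at most `m` bounded by `C` and the `m`-th one `α`-Hölder with constant `C`. -/
def HolderBound {E : Type u} [NormedAddCommGroup E] [NormedSpace ℝ E] (α C : ℝ) :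
    ∀ (_ : ℕ) {F : Type u} [NormedAddCommGroup F] [NormedSpace ℝ F] (_ : E → F), Prop
  | 0, _, _, _, f => (∀ x, ‖f x‖ ≤ C) ∧ ∀ x y, ‖f x - f y‖ ≤ C * ‖x - y‖ ^ α
  | m + 1, _, _, _, f => Differentiable ℝ f ∧ (∀ x, ‖f x‖ ≤ C) ∧ HolderBound α C m (fderiv ℝ f)

variable {α β C C' : ℝ} {m : ℕ}

theorem HolderBound.norm_le {f : E → F} (h : HolderBound α C m f) (x : E) : ‖f x‖ ≤ C := by
  cases m with
  | zero => exact h.1 x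
  | succ m => exact h.2.1 x

theorem HolderBound.nonneg {f : E → F} (h : HolderBound α C m f) : 0 ≤ C :=
  (norm_nonneg _).trans (h.norm_le 0)

theorem HolderBound.mono {f : E → F} (h : HolderBound α C m f) (hC : C ≤ C') :
    HolderBound α C' m f := by
  induction m generalizing F with
  | zero =>
    exact ⟨fun x => (h.1 x).trans hC, fun x y => (h.2 x y).trans (by gcongr)⟩
  | succ m ih => exact ⟨h.1, fun x => (h.2.1 x).trans hC, ih h.2.2⟩

theorem norm_sub_le_of_norm_fderiv_le {f : E → F} (hf : Differentiable ℝ f)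
    (h : ∀ x, ‖fderiv ℝ f x‖ ≤ C) (x y : E) : ‖f x - f y‖ ≤ C * ‖x - y‖ :=
  convex_univ.norm_image_sub_le_of_norm_fderiv_le (fun z _ => hf z) (fun z _ => h z)
    (mem_univ y) (mem_univ x)

theorem HolderBound.norm_sub_le {f : E → F} (h : HolderBound α C (m + 1) f) (x y : E) :
    ‖f x - f y‖ ≤ C * ‖x - y‖ :=
  norm_sub_le_of_norm_fderiv_le h.1 h.2.2.norm_le x y

theorem le_two_mul_rpow {a t : ℝ} (hC : 0 ≤ C) (ht : 0 ≤ t) (hα : 0 < α) (hαβ : α ≤ β)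
    (h₁ : a ≤ 2 * C) (h₂ : a ≤ C * t ^ β) : a ≤ 2 * C * t ^ α := by
  rcases le_total t 1 with h | h
  · have : t ^ β ≤ t ^ α := Real.rpow_le_rpow_of_exponent_ge' ht h hα.le hαβ
    have h0 : 0 ≤ t ^ α := by positivity
    nlinarith [mul_le_mul_of_nonneg_left this hC, mul_nonneg hC h0]
  · have : 1 ≤ t ^ α := Real.one_le_rpow h hα.le
    nlinarith

theorem HolderBound.of_exponent_le {f : E → F} (hα : 0 < α) (hαβ : α ≤ β)
    (h : HolderBound β C m f) : HolderBound α (2 * C) m f := by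
  induction m generalizing F with
  | zero =>
    have hC := h.nonneg
    refine ⟨fun x => (h.1 x).trans (by linarith), fun x y => ?_⟩
    refine le_two_mul_rpow hC (norm_nonneg _) hα hαβ ?_ (h.2 x y)
    linarith [_root_.norm_sub_le (f x) (f y), h.1 x, h.1 y]
  | succ m ih =>
    have hC := h.nonneg
    exact ⟨h.1, fun x => (h.2.1 x).trans (by linarith), ih h.2.2⟩

theorem HolderBound.of_succ {f : E → F} (hα : 0 < α) (hα1 : α ≤ 1)
    (h : HolderBound α C (m + 1) f) : HolderBound α (2 * C) m f := by
  have hC := h.nonneg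
  induction m generalizing F with
  | zero =>
    refine ⟨fun x => (h.norm_le x).trans (by linarith), fun x y => ?_⟩
    refine le_two_mul_rpow hC (norm_nonneg _) hα hα1 ?_ (by simpa using h.norm_sub_le x y)
    linarith [_root_.norm_sub_le (f x) (f y), h.norm_le x, h.norm_le y]
  | succ m ih =>
    exact ⟨h.1, fun x => (h.2.1 x).trans (by linarith), ih h.2.2⟩

theorem HolderBound.zero (hC : 0 ≤ C) : HolderBound α C m (0 : E → F) := by
  induction m generalizing F with
  | zero => exact ⟨fun x => by simpa, fun x y => by simp; positivity⟩
  | succ m ih =>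
    refine ⟨differentiable_const _, fun x => by simpa, ?_⟩
    rw [fderiv_zero]
    exact ih

theorem HolderBound.const (c : F) : HolderBound α ‖c‖ m (fun _ : E => c) := by
  cases m with
  | zero => exact ⟨fun x => le_rfl, fun x y => by simp; positivity⟩
  | succ m =>
    refine ⟨differentiable_const _, fun x => le_rfl, ?_⟩
    rw [fderiv_fun_const]
    exact HolderBound.zero (norm_nonneg _)

theorem HolderBound.add {f g : E → F} (hf : HolderBound α C m f) (hg : HolderBound α C' m g) :
    HolderBound α (C + C') m (fun x => f x + g x) := by
  induction m generalizing F with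
  | zero =>
    refine ⟨fun x => (norm_add_le _ _).trans (add_le_add (hf.1 x) (hg.1 x)), fun x y => ?_⟩
    rw [add_sub_add_comm, add_mul]
    exact (norm_add_le _ _).trans (add_le_add (hf.2 x y) (hg.2 x y))
  | succ m ih =>
    refine ⟨hf.1.add hg.1, fun x => (norm_add_le _ _).trans
      (add_le_add (hf.2.1 x) (hg.2.1 x)), ?_⟩
    have : fderiv ℝ (fun x => f x + g x) = fun x => fderiv ℝ f x + fderiv ℝ g x :=
      funext fun x => fderiv_fun_add (hf.1 x) (hg.1 x)
    rw [this]
    exact ih hf.2.2 hg.2.2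

theorem HolderBound.neg {f : E → F} (hf : HolderBound α C m f) :
    HolderBound α C m (fun x => -f x) := by
  induction m generalizing F with
  | zero =>
    refine ⟨fun x => (norm_neg _).trans_le (hf.1 x), fun x y => ?_⟩
    rw [← neg_sub', norm_neg]
    exact hf.2 x y
  | succ m ih =>
    refine ⟨hf.1.neg, fun x => (norm_neg _).trans_le (hf.2.1 x), ?_⟩
    have : fderiv ℝ (fun x => -f x) = fun x => -fderiv ℝ f x := funext fun x => fderiv_fun_neg
    rw [this]
    exact ih hf.2.2

theorem HolderBound.sub {f g : E → F} (hf : HolderBound α C m f) (hg : HolderBound α C' m g) :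
    HolderBound α (C + C') m (fun x => f x - g x) := by
  simpa only [sub_eq_add_neg] using hf.add hg.neg

theorem HolderBound.bilinear (hα : 0 < α) (hα1 : α ≤ 1) (B : F →L[ℝ] G →L[ℝ] H) (hB : ‖B‖ ≤ 1)
    {f : E → F} {g : E → G} (hf : HolderBound α C m f) (hg : HolderBound α C' m g) :
    HolderBound α (2 * 4 ^ m * (C * C')) m (fun x => B (f x) (g x)) := by
  have hC := hf.nonneg
  have hC' := hg.nonneg
  have key : ∀ (a : F) (b : G), ‖B a b‖ ≤ ‖a‖ * ‖b‖ := fun a b =>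
    (B.le_opNorm₂ a b).trans (by
      rw [mul_assoc]
      exact mul_le_of_le_one_left (by positivity) hB)
  have sup : ∀ x, ‖B (f x) (g x)‖ ≤ C * C' := fun x =>
    (key _ _).trans (mul_le_mul (hf.norm_le x) (hg.norm_le x) (norm_nonneg _) hC)
  induction m generalizing F G H C C' with
  | zero =>
    refine ⟨fun x => (sup x).trans (by nlinarith [mul_nonneg hC hC']), fun x y => ?_⟩
    have : B (f x) (g x) - B (f y) (g y) = B (f x - f y) (g x) + B (f y) (g x - g y) := by
      simp
    rw [this]
    calc _ ≤ ‖f x - f y‖ * ‖g x‖ + ‖f y‖ * ‖g x - g y‖ :=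
          (norm_add_le _ _).trans (add_le_add (key _ _) (key _ _))
      _ ≤ (C * ‖x - y‖ ^ α) * C' + C * (C' * ‖x - y‖ ^ α) := by
          gcongr
          · exact hf.2 x y
          · exact hg.1 x
          · exact hf.1 y
          · exact hg.2 x y
      _ = _ := by ring
  | succ m ih =>
    have h4 : (1 : ℝ) ≤ 4 ^ (m + 1) := one_le_pow₀ (by norm_num)
    refine ⟨B.isBoundedBilinearMap.differentiable.comp (hf.1.prodMk hg.1),
      fun x => (sup x).trans (by nlinarith [mul_nonneg hC hC']), ?_⟩
    have : fderiv ℝ (fun x => B (f x) (g x)) =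
        fun x => B.precompR E (f x) (fderiv ℝ g x) + B.precompL E (fderiv ℝ f x) (g x) :=
      funext fun x => B.fderiv_of_bilinear (hf.1 x) (hg.1 x)
    rw [this]
    have hr : ‖B.precompR E‖ ≤ 1 := (B.norm_precompR_le E).trans hB
    have hl : ‖B.precompL E‖ ≤ 1 := (B.norm_precompL_le E).trans hB
    have hf' := hf.of_succ hα hα1
    have hg' := hg.of_succ hα hα1
    have nr : ∀ a b, ‖B.precompR E a b‖ ≤ ‖a‖ * ‖b‖ := fun a b =>
      ((B.precompR E).le_opNorm₂ a b).trans (by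
        rw [mul_assoc]; exact mul_le_of_le_one_left (by positivity) hr)
    have nl : ∀ a b, ‖B.precompL E a b‖ ≤ ‖a‖ * ‖b‖ := fun a b =>
      ((B.precompL E).le_opNorm₂ a b).trans (by
        rw [mul_assoc]; exact mul_le_of_le_one_left (by positivity) hl)
    refine ((ih (B.precompR E) hr hf' hg.2.2 hf'.nonneg hC' nr fun x => ?_).add
      (ih (B.precompL E) hl hf.2.2 hg' hC hg'.nonneg nl fun x => ?_)).mono ?_
    · exact (nr _ _).trans (mul_le_mul (hf'.norm_le x) (hg.2.2.norm_le x) (norm_nonneg _)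
        hf'.nonneg)
    · exact (nl _ _).trans (mul_le_mul (hf.2.2.norm_le x) (hg'.norm_le x) (norm_nonneg _) hC)
    · rw [pow_succ]
      exact le_of_eq (by ring)

theorem HolderBound.clm_apply (hα : 0 < α) (hα1 : α ≤ 1) {f : E → F →L[ℝ] G} {g : E → F}
    (hf : HolderBound α C m f) (hg : HolderBound α C' m g) :
    HolderBound α (2 * 4 ^ m * (C * C')) m (fun x => f x (g x)) :=
  HolderBound.bilinear hα hα1 (ContinuousLinearMap.id ℝ (F →L[ℝ] G))
    ContinuousLinearMap.norm_id_le hf hg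

theorem HolderBound.clm_comp (hα : 0 < α) (hα1 : α ≤ 1) {f : E → F →L[ℝ] G}
    {g : E → H →L[ℝ] F} (hf : HolderBound α C m f) (hg : HolderBound α C' m g) :
    HolderBound α (2 * 4 ^ m * (C * C')) m (fun x => (f x).comp (g x)) :=
  HolderBound.bilinear hα hα1 (ContinuousLinearMap.compL ℝ H F G)
    (ContinuousLinearMap.norm_compL_le ℝ H F G) hf hg

theorem HolderBound.id_add_fderiv {ψ : E → E} (h : HolderBound α C (m + 1) ψ) :
    HolderBound α (1 + C) m (fun x => ContinuousLinearMap.id ℝ E + fderiv ℝ ψ x) :=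
  ((HolderBound.const _).mono ContinuousLinearMap.norm_id_le).add h.2.2

theorem hasFDerivAt_comp_id_add {h : E → G} {ψ : E → E} (hh : Differentiable ℝ h)
    (hψ : Differentiable ℝ ψ) (x : E) :
    HasFDerivAt (fun x => h (x + ψ x))
      ((fderiv ℝ h (x + ψ x)).comp (ContinuousLinearMap.id ℝ E + fderiv ℝ ψ x)) x :=
  HasFDerivAt.comp x (hh _).hasFDerivAt ((hasFDerivAt_id x).add (hψ x).hasFDerivAt)

theorem norm_id_add_sub_le {V : Type*} [NormedAddCommGroup V] {ψ : V → V} {L : ℝ}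
    (hψL : ∀ x y, ‖ψ x - ψ y‖ ≤ L * ‖x - y‖)
    (x y : V) : ‖(x + ψ x) - (y + ψ y)‖ ≤ (1 + L) * ‖x - y‖ := by
  rw [add_sub_add_comm, add_mul, one_mul]
  exact (norm_add_le _ _).trans (by gcongr; exact hψL x y)

theorem HolderBound.comp_id_add_zero {h : E → G} {ψ : E → E} {L : ℝ} (hβ : 0 ≤ β) (hL : 0 ≤ L)
    (hh : HolderBound β C 0 h) (hψL : ∀ x y, ‖ψ x - ψ y‖ ≤ L * ‖x - y‖) :
    HolderBound β (C * (1 + L) ^ β) 0 (fun x => h (x + ψ x)) := by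
  have hC := hh.nonneg
  have h1 : 1 ≤ (1 + L) ^ β := Real.one_le_rpow (by linarith) hβ
  refine ⟨fun x => (hh.1 _).trans (le_mul_of_one_le_right hC h1), fun x y => ?_⟩
  calc _ ≤ C * ‖(x + ψ x) - (y + ψ y)‖ ^ β := hh.2 _ _
    _ ≤ C * ((1 + L) * ‖x - y‖) ^ β := by
        gcongr
        exact norm_id_add_sub_le hψL x y
    _ = _ := by rw [Real.mul_rpow (by positivity) (norm_nonneg _), mul_assoc]

theorem HolderBound.exists_comp_id_add (hα : 0 < α) (hαβ : α ≤ β) (hβ : β ≤ 1) {h : E → G}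
    (hh : HolderBound β C m h) {ψ : E → E} {D L : ℝ} (hψ : HolderBound α D m ψ) (hL : 0 ≤ L)
    (hψL : ∀ x y, ‖ψ x - ψ y‖ ≤ L * ‖x - y‖) :
    ∃ K, HolderBound α K m (fun x => h (x + ψ x)) := by
  have hα1 := hαβ.trans hβ
  induction m generalizing G C D with
  | zero =>
    exact ⟨_, (hh.comp_id_add_zero (hα.le.trans hαβ) hL hψL).of_exponent_le hα hαβ⟩
  | succ m ih =>
    obtain ⟨K, hK⟩ := ih hh.2.2 (hψ.of_succ hα hα1)
    refine ⟨max C (2 * 4 ^ m * (K * (1 + D))),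
      fun x => (hasFDerivAt_comp_id_add hh.1 hψ.1 x).differentiableAt,
      fun x => (hh.norm_le _).trans (le_max_left _ _), ?_⟩
    have : fderiv ℝ (fun x => h (x + ψ x)) = _ :=
      funext fun x => (hasFDerivAt_comp_id_add hh.1 hψ.1 x).fderiv
    rw [this]
    exact (hK.clm_comp hα hα1 hψ.id_add_fderiv).mono (le_max_right _ _)

theorem exists_pos_mul_rpow_le {c γ ε : ℝ} (hc : 0 ≤ c) (hγ : 0 < γ) (hε : 0 < ε) :
    ∃ s > 0, c * s ^ γ ≤ ε := by
  refine ⟨(ε / (c + 1)) ^ γ⁻¹, by positivity, ?_⟩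
  rw [Real.rpow_inv_rpow (by positivity) hγ.ne', mul_div_assoc', div_le_iff₀ (by positivity)]
  nlinarith

/-- Continuity of `ψ ↦ h ∘ (Id + ψ)` at `ψ₀`, along uniformly Lipschitz `ψ`. -/
theorem HolderBound.exists_comp_id_add_sub (hα : 0 < α) (hαβ : α < β) (hβ : β ≤ 1)
    {h : E → G} (hh : HolderBound β C m h) {ψ₀ : E → E} {D L : ℝ} (hψ₀ : HolderBound α D m ψ₀)
    (hL : 0 ≤ L) (hψ₀L : ∀ x y, ‖ψ₀ x - ψ₀ y‖ ≤ L * ‖x - y‖) {ε : ℝ} (hε : 0 < ε) :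
    ∃ δ > 0, ∀ ψ : E → E, HolderBound α δ m (fun x => ψ x - ψ₀ x) →
      (∀ x y, ‖ψ x - ψ y‖ ≤ L * ‖x - y‖) →
      HolderBound α ε m (fun x => h (x + ψ x) - h (x + ψ₀ x)) := by
  have hα1 := hαβ.le.trans hβ
  have hβ0 := hα.trans hαβ
  have hC := hh.nonneg
  induction m generalizing G C D ε with
  | zero =>
    set N := C * (1 + L) ^ β with hN
    have hN0 : 0 ≤ N := by positivity
    obtain ⟨s, hs, hsε⟩ := exists_pos_mul_rpow_le (c := 2 * N) (by positivity)
      (sub_pos.2 hαβ) hε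
    obtain ⟨δ, hδ, hδε⟩ := exists_pos_mul_rpow_le hC hβ0
      (ε := min ε (ε * s ^ α / 2)) (lt_min hε (by positivity))
    refine ⟨δ, hδ, fun ψ hψ hψL => ?_⟩
    have sup : ∀ x, ‖h (x + ψ x) - h (x + ψ₀ x)‖ ≤ C * δ ^ β := fun x => by
      refine (hh.2 _ _).trans ?_
      gcongr
      simpa using hψ.1 x
    refine ⟨fun x => (sup x).trans (hδε.trans (min_le_left _ _)), fun x y => ?_⟩
    rcases le_total ‖x - y‖ s with hxs | hxs
    · have h1 := (hh.comp_id_add_zero hβ0.le hL hψL).2 x y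
      have h2 := (hh.comp_id_add_zero hβ0.le hL hψ₀L).2 x y
      rw [sub_sub_sub_comm]
      have hsplit : ‖x - y‖ ^ β = ‖x - y‖ ^ (β - α) * ‖x - y‖ ^ α := by
        rw [← Real.rpow_add_of_nonneg (norm_nonneg _) (sub_pos.2 hαβ).le hα.le, sub_add_cancel]
      calc _ ≤ N * ‖x - y‖ ^ β + N * ‖x - y‖ ^ β :=
            (_root_.norm_sub_le _ _).trans (add_le_add h1 h2)
        _ = (2 * N * ‖x - y‖ ^ (β - α)) * ‖x - y‖ ^ α := by rw [hsplit]; ring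
        _ ≤ (2 * N * s ^ (β - α)) * ‖x - y‖ ^ α := by
            have := Real.rpow_le_rpow (norm_nonneg _) hxs (sub_pos.2 hαβ).le
            gcongr
        _ ≤ _ := by gcongr
    · calc _ ≤ C * δ ^ β + C * δ ^ β := (_root_.norm_sub_le _ _).trans (add_le_add (sup x) (sup y))
        _ ≤ ε * s ^ α := by linarith [hδε.trans (min_le_right _ _)]
        _ ≤ _ := by gcongr
  | succ m ih =>
    have hψ₀' := hψ₀.of_succ hα hα1
    have hD := hψ₀.nonneg
    obtain ⟨K, hK⟩ := hh.2.2.exists_comp_id_add hα hαβ.le hβ hψ₀' hL hψ₀L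
    have hK0 := hK.nonneg
    obtain ⟨δ₁, hδ₁, H₁⟩ := ih (ε := ε / 2 / (2 * 4 ^ m * (1 + (1 + D)))) hh.2.2 hψ₀'
      (by positivity) hC
    obtain ⟨δ₂, hδ₂, H₂⟩ := ih (ε := ε) (hh.of_succ hβ0 hβ) hψ₀' hε (by positivity)
    refine ⟨min (min 1 (ε / 2 / (2 * 4 ^ m * (K + 1)))) (min (δ₁ / 2) (δ₂ / 2)),
      by positivity, fun ψ hφ hψL => ?_⟩
    have hψ : HolderBound α (1 + D) (m + 1) ψ := by
      simpa using (hφ.mono ((min_le_left _ _).trans (min_le_left _ _))).add hψ₀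
    have hφ₁ := (hφ.mono ((min_le_right _ _).trans (min_le_left _ _))).of_succ hα hα1
    have hφ₂ := (hφ.mono ((min_le_right _ _).trans (min_le_right _ _))).of_succ hα hα1
    rw [mul_div_cancel₀ _ two_ne_zero] at hφ₁ hφ₂
    have hd := fun x => (hasFDerivAt_comp_id_add hh.1 hψ.1 x).sub
      (hasFDerivAt_comp_id_add hh.1 hψ₀.1 x)
    refine ⟨fun x => (hd x).differentiableAt, (H₂ ψ hφ₂ hψL).norm_le, ?_⟩
    have e : fderiv ℝ (fun x => h (x + ψ x) - h (x + ψ₀ x)) = fun x =>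
        (fderiv ℝ h (x + ψ x) - fderiv ℝ h (x + ψ₀ x)).comp
          (ContinuousLinearMap.id ℝ E + fderiv ℝ ψ x) +
        (fderiv ℝ h (x + ψ₀ x)).comp (fderiv ℝ (fun x => ψ x - ψ₀ x) x) := by
      funext x
      refine (hd x).fderiv.trans ?_
      rw [fderiv_fun_sub (hψ.1 x) (hψ₀.1 x)]
      ext v
      simp
      abel
    rw [e]
    have hφ₃ := (hφ.mono ((min_le_left _ _).trans (min_le_right _ _))).2.2
    refine (((H₁ ψ hφ₁ hψL).clm_comp hα hα1 hψ.id_add_fderiv).add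
      (hK.clm_comp hα hα1 hφ₃)).mono ?_
    have e₁ : 2 * 4 ^ m * (ε / 2 / (2 * 4 ^ m * (1 + (1 + D))) * (1 + (1 + D))) = ε / 2 := by
      field_simp
    have e₂ : 2 * 4 ^ m * (K * (ε / 2 / (2 * 4 ^ m * (K + 1)))) ≤ ε / 2 := by
      have : 2 * 4 ^ m * (K * (ε / 2 / (2 * 4 ^ m * (K + 1)))) = ε / 2 * (K / (K + 1)) := by
        field_simp
      rw [this]
      exact mul_le_of_le_one_right (by positivity) ((div_le_one (by positivity)).2 (by linarith))
    linarith

/-- First-order Taylor estimate for `ψ ↦ g ∘ (Id + ψ)` at `ψ₀`, along uniformly Lipschitz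
increments. -/
theorem HolderBound.exists_comp_id_add_remainder (hα : 0 < α) (hαβ : α < β) (hβ : β ≤ 1)
    {g : E → G} (hg : HolderBound β C (m + 1) g) {ψ₀ : E → E} {D L : ℝ}
    (hψ₀ : HolderBound α D m ψ₀) (hL : 0 ≤ L) (hψ₀L : ∀ x y, ‖ψ₀ x - ψ₀ y‖ ≤ L * ‖x - y‖)
    {ε : ℝ} (hε : 0 < ε) :
    ∃ δ > 0, ∀ (φ : E → E) (r : ℝ), HolderBound α r m φ → r ≤ δ →
      (∀ x y, ‖φ x - φ y‖ ≤ 1 * ‖x - y‖) →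
      HolderBound α (ε * r) m (fun x =>
        g (x + ψ₀ x + φ x) - g (x + ψ₀ x) - fderiv ℝ g (x + ψ₀ x) (φ x)) := by
  have hα1 := hαβ.le.trans hβ
  have hβ0 := hα.trans hαβ
  induction m generalizing G C D ε with
  | zero =>
    obtain ⟨δ, hδ, H⟩ := hg.2.2.exists_comp_id_add_sub (L := L + 1) hα hαβ hβ hψ₀ (by positivity)
      (fun x y => (hψ₀L x y).trans (by gcongr; linarith)) (half_pos hε)
    refine ⟨δ, hδ, fun φ r hφ hr hφL => ?_⟩
    set Q : E → ℝ → G := fun x t =>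
      g (x + ψ₀ x + t • φ x) - t • fderiv ℝ g (x + ψ₀ x) (φ x) with hQ
    set A : E → ℝ → G := fun x t =>
      (fderiv ℝ g (x + ψ₀ x + t • φ x) - fderiv ℝ g (x + ψ₀ x)) (φ x) with hA
    have hQA : ∀ x t, HasDerivAt (Q x) (A x t) t := fun x t => by
      have h1 : HasDerivAt (fun t : ℝ => x + ψ₀ x + t • φ x) (φ x) t := by
        simpa using ((hasDerivAt_id t).smul_const (φ x)).const_add (x + ψ₀ x)
      have h2 : HasDerivAt (fun t : ℝ => t • fderiv ℝ g (x + ψ₀ x) (φ x))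
          (fderiv ℝ g (x + ψ₀ x) (φ x)) t := by
        simpa using (hasDerivAt_id t).smul_const (fderiv ℝ g (x + ψ₀ x) (φ x))
      exact ((hg.1 _).hasFDerivAt.comp_hasDerivAt t h1).sub h2
    have hAt : ∀ t ∈ Ico (0 : ℝ) 1, HolderBound α (ε * r) 0 (fun x => A x t) := fun t ht => by
      have hn : ∀ v : E, ‖t • v‖ ≤ ‖v‖ := fun v => by
        rw [norm_smul, Real.norm_of_nonneg ht.1]
        exact mul_le_of_le_one_left (norm_nonneg _) ht.2.le
      have h1 := H (fun x => ψ₀ x + t • φ x) ?_ ?_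
      · have h2 : HolderBound α (ε * r) 0 _ :=
          (h1.clm_apply hα hα1 hφ).mono (le_of_eq (by ring))
        simpa only [hA, add_assoc] using h2
      · simp only [add_sub_cancel_left]
        refine ⟨fun x => (hn _).trans ((hφ.1 x).trans hr), fun x y => ?_⟩
        rw [← smul_sub]
        exact (hn _).trans ((hφ.2 x y).trans (by gcongr))
      · intro x y
        rw [add_sub_add_comm, ← smul_sub, add_mul]
        exact (norm_add_le _ _).trans (add_le_add (hψ₀L x y) ((hn _).trans (hφL x y)))
    have hR : ∀ x, g (x + ψ₀ x + φ x) - g (x + ψ₀ x) - fderiv ℝ g (x + ψ₀ x) (φ x) =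
        Q x 1 - Q x 0 := fun x => by
      simp only [hQ, one_smul, zero_smul, add_zero, sub_zero]
      abel
    simp only [hR]
    refine ⟨fun x => norm_image_sub_le_of_norm_deriv_le_segment_01'
      (fun t _ => (hQA x t).hasDerivWithinAt) fun t ht => (hAt t ht).1 x, fun x y => ?_⟩
    rw [sub_sub_sub_comm]
    exact norm_image_sub_le_of_norm_deriv_le_segment_01' (f := fun t => Q x t - Q y t)
      (fun t _ => ((hQA x t).sub (hQA y t)).hasDerivWithinAt) fun t ht => (hAt t ht).2 x y
  | succ m ih =>
    have hψ₀' := hψ₀.of_succ hα hα1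
    have hD := hψ₀.nonneg
    set g' := fderiv ℝ g with hg'
    have hg1 : HolderBound β C (m + 1) g' := hg.2.2
    obtain ⟨δ₁, hδ₁, H₁⟩ := ih (ε := ε / 2 / (4 * 4 ^ m * (1 + D))) hg1 hψ₀' (by positivity)
    obtain ⟨δ₂, hδ₂, H₂⟩ := ih (ε := ε / 2) (hg.of_succ hβ0 hβ) hψ₀' (by positivity)
    obtain ⟨δ₃, hδ₃, H₃⟩ := (hg1.of_succ hβ0 hβ).exists_comp_id_add_sub (L := L + 1) hα hαβ hβ
      hψ₀' (by positivity) (fun x y => (hψ₀L x y).trans (by gcongr; linarith))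
      (show 0 < ε / 2 / (2 * 4 ^ m) by positivity)
    refine ⟨min (δ₁ / 2) (min (δ₂ / 2) (δ₃ / 2)), by positivity, fun φ r hφ hr hφL => ?_⟩
    have hφ' := hφ.of_succ hα hα1
    have hr₁ : 2 * r ≤ δ₁ := by linarith [hr.trans (min_le_left _ _)]
    have hr₂ : 2 * r ≤ δ₂ := by linarith [(hr.trans (min_le_right _ _)).trans (min_le_left _ _)]
    have hr₃ : 2 * r ≤ δ₃ := by linarith [(hr.trans (min_le_right _ _)).trans (min_le_right _ _)]
    have hφd : ∀ x, HasFDerivAt φ (fderiv ℝ φ x) x := fun x => (hφ.1 x).hasFDerivAt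
    have hψφ : Differentiable ℝ (fun x => ψ₀ x + φ x) := hψ₀.1.add hφ.1
    have hd := fun x => ((hasFDerivAt_comp_id_add hg.1 hψφ x).sub
      (hasFDerivAt_comp_id_add hg.1 hψ₀.1 x)).sub
      ((hasFDerivAt_comp_id_add hg1.1 hψ₀.1 x).clm_apply (hφd x))
    simp only [← add_assoc] at hd
    refine ⟨fun x => (hd x).differentiableAt, fun x => ?_, ?_⟩
    · exact ((H₂ φ _ hφ' hr₂ hφL).norm_le x).trans (le_of_eq (by ring))
    have e : fderiv ℝ (fun x => g (x + ψ₀ x + φ x) - g (x + ψ₀ x) - g' (x + ψ₀ x) (φ x)) =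
        fun x => (g' (x + ψ₀ x + φ x) - g' (x + ψ₀ x) - fderiv ℝ g' (x + ψ₀ x) (φ x)).comp
            (ContinuousLinearMap.id ℝ E + fderiv ℝ ψ₀ x) +
          (g' (x + ψ₀ x + φ x) - g' (x + ψ₀ x)).comp (fderiv ℝ φ x) := by
      funext x
      refine (hd x).fderiv.trans ?_
      rw [fderiv_fun_add (hψ₀.1 x) (hφ.1 x)]
      ext v
      have hsymm : ∀ w, fderiv ℝ g' (x + ψ₀ x) w (φ x) = fderiv ℝ g' (x + ψ₀ x) (φ x) w :=
        fun w => second_derivative_symmetric (fun y => (hg.1 y).hasFDerivAt)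
          (hg1.1 (x + ψ₀ x)).hasFDerivAt w (φ x)
      simp [← hg', hsymm v, hsymm (fderiv ℝ ψ₀ x v), add_assoc]
      abel
    rw [e]
    have h₃ := H₃ (fun x => ψ₀ x + φ x) (by simpa using hφ'.mono hr₃) fun x y => by
      rw [add_sub_add_comm, add_mul]
      exact (norm_add_le _ _).trans (add_le_add (hψ₀L x y) (hφL x y))
    simp only [← add_assoc] at h₃
    refine (((H₁ φ _ hφ' hr₁ hφL).clm_comp hα hα1 hψ₀.id_add_fderiv).add
      (h₃.clm_comp hα hα1 hφ.2.2)).mono (le_of_eq ?_)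
    field_simp
    ring

theorem HolderBound.continuous {f : E → F} (hα : 0 < α) (h : HolderBound α C m f) :
    Continuous f := by
  cases m with
  | zero =>
    refine continuous_iff_continuousAt.2 fun x => tendsto_iff_norm_sub_tendsto_zero.2 ?_
    refine squeeze_zero (fun _ => norm_nonneg _) (fun y => h.2 y x) ?_
    have : Continuous fun y : E => C * ‖y - x‖ ^ α :=
      continuous_const.mul ((continuous_id.sub continuous_const).norm.rpow_const
        fun _ => Or.inr hα.le)
    simpa [hα.ne'] using this.tendsto x
  | succ m => exact h.1.continuous

theorem holderBound_iff (hα : 0 < α) {f : E → F} : HolderBound α C m f ↔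
    ContDiff ℝ (m : ℕ∞) f ∧ (∀ l ≤ m, ∀ x, ‖iteratedFDeriv ℝ l f x‖ ≤ C) ∧
      ∀ x y, ‖iteratedFDeriv ℝ m f x - iteratedFDeriv ℝ m f y‖ ≤ C * ‖x - y‖ ^ α := by
  induction m generalizing F with
  | zero =>
    have e : ∀ x y, ‖iteratedFDeriv ℝ 0 f x - iteratedFDeriv ℝ 0 f y‖ = ‖f x - f y‖ :=
      fun x y => by
        simp only [iteratedFDeriv_zero_eq_comp, comp_apply]
        rw [← map_sub, LinearIsometryEquiv.norm_map]
    simp only [e, Nat.le_zero, forall_eq, norm_iteratedFDeriv_zero]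
    exact ⟨fun h => ⟨contDiff_zero.2 (h.continuous hα), h⟩, fun h => h.2⟩
  | succ m ih =>
    have e : ∀ x y, ‖iteratedFDeriv ℝ (m + 1) f x - iteratedFDeriv ℝ (m + 1) f y‖ =
        ‖iteratedFDeriv ℝ m (fderiv ℝ f) x - iteratedFDeriv ℝ m (fderiv ℝ f) y‖ :=
      fun x y => by
        simp only [iteratedFDeriv_succ_eq_comp_right, comp_apply]
        rw [← map_sub, LinearIsometryEquiv.norm_map]
    have hc : ContDiff ℝ ((m + 1 : ℕ) : ℕ∞) f ↔
        Differentiable ℝ f ∧ ContDiff ℝ (m : ℕ∞) (fderiv ℝ f) := by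
      have := contDiff_succ_iff_fderiv (𝕜 := ℝ) (n := ((m : ℕ∞) : WithTop ℕ∞)) (f := f)
      simpa using this
    rw [hc]
    simp only [e]
    constructor
    · rintro ⟨h1, h2, h3⟩
      obtain ⟨h4, h5, h6⟩ := ih.1 h3
      refine ⟨⟨h1, h4⟩, fun l hl x => ?_, h6⟩
      cases l with
      | zero => simpa using h2 x
      | succ l =>
        rw [← norm_iteratedFDeriv_fderiv]
        exact h5 l (by omega) x
    · rintro ⟨⟨h1, h4⟩, h5, h6⟩
      refine ⟨h1, fun x => by simpa using h5 0 (by omega) x, ih.2 ⟨h4, fun l hl x => ?_, h6⟩⟩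
      rw [norm_iteratedFDeriv_fderiv]
      exact h5 (l + 1) (by omega) x

theorem eHnorm_le_ofReal_iff (hα : 0 < α) (hC : 0 ≤ C) {f : E → F} :
    eHnorm m α f ≤ ENNReal.ofReal C ↔ (∀ l ≤ m, ∀ x, ‖iteratedFDeriv ℝ l f x‖ ≤ C) ∧
      ∀ x y, ‖iteratedFDeriv ℝ m f x - iteratedFDeriv ℝ m f y‖ ≤ C * ‖x - y‖ ^ α := by
  have hn : ∀ {V : Type u} [NormedAddCommGroup V] (v : V),
      (‖v‖₊ : ℝ≥0∞) = ENNReal.ofReal ‖v‖ := fun v => (ofReal_norm v).symm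
  rw [eHnorm, max_le_iff, eCnb, eHsemi]
  simp only [iSup_le_iff, hn]
  refine and_congr ⟨fun h l hl x => ?_, fun h l x => ?_⟩ (forall₂_congr fun x y => ?_)
  · exact (ENNReal.ofReal_le_ofReal_iff hC).1 (h ⟨l, by omega⟩ x)
  · exact ENNReal.ofReal_le_ofReal (h l (by omega) x)
  · rcases eq_or_ne x y with rfl | hxy
    · simp [hα.ne']
    · have hpos : 0 < ‖x - y‖ := norm_pos_iff.2 (sub_ne_zero.2 hxy)
      have hp : 0 < ‖x - y‖ ^ α := by positivity
      rw [edist_dist, dist_eq_norm, ENNReal.ofReal_rpow_of_pos hpos, ← ENNReal.ofReal_div_of_pos hp,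
        ENNReal.ofReal_le_ofReal_iff hC, div_le_iff₀ hp]
      simp [hxy]

theorem MemCb.holderBound (hα : 0 < α) {f : E → F} (h : MemCb m α f) :
    HolderBound α (hnorm m α f) m f :=
  (holderBound_iff hα).2 ⟨h.1, (eHnorm_le_ofReal_iff hα ENNReal.toReal_nonneg).1
    (ENNReal.ofReal_toReal h.2.ne).ge⟩

theorem HolderBound.eHnorm_le (hα : 0 < α) {f : E → F} (h : HolderBound α C m f) :
    eHnorm m α f ≤ ENNReal.ofReal C :=
  (eHnorm_le_ofReal_iff hα h.nonneg).2 ((holderBound_iff hα).1 h).2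

theorem HolderBound.memCb (hα : 0 < α) {f : E → F} (h : HolderBound α C m f) : MemCb m α f :=
  ⟨((holderBound_iff hα).1 h).1, (h.eHnorm_le hα).trans_lt ENNReal.ofReal_lt_top⟩

theorem HolderBound.hnorm_le (hα : 0 < α) {f : E → F} (h : HolderBound α C m f) :
    hnorm m α f ≤ C :=
  ENNReal.toReal_le_of_le_ofReal h.nonneg (h.eHnorm_le hα)

end HolderBound

/-- C¹ left translations, de la Llave–Obaya 6.7:
for `g ∈ C^{m+1,β}_b(ℝ^d,G)` and `0 < α < β ≤ 1`, the left translation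
`g_⋆ : C^{m,α}_b(ℝ^d,ℝ^d) → C^{m,α}_b(ℝ^d,G)`, `g_⋆(f) = g∘(Id+f)`, is
continuously Fréchet differentiable with `d(g_⋆)(ψ)(φ) = (x ↦ dg(x+ψ(x))·φ(x))`:
the candidate derivative maps into `C^{m,α}_b` and is a bounded linear map,
it is the Fréchet derivative of `g_⋆` at every point, and it depends
continuously (in operator norm) on the base point. -/
theorem stmt3 (d m : ℕ) (hm : 1 ≤ m) (α β : ℝ) (hα : 0 < α) (hαβ : α < β) (hβ : β ≤ 1)
    (G : Type) [NormedAddCommGroup G] [NormedSpace ℝ G] [CompleteSpace G]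
    (g : Euc d → G) (hg : MemCb (m + 1) β g) :
    -- the candidate derivative is a bounded linear operator on `C^{m,α}_b`
    (∀ ψ : Euc d → Euc d, MemCb m α ψ →
      (∀ φ : Euc d → Euc d, MemCb m α φ →
        MemCb m α (fun x => fderiv ℝ g (x + ψ x) (φ x))) ∧
      ∃ K : ℝ, ∀ φ : Euc d → Euc d, MemCb m α φ →
        hnorm m α (fun x => fderiv ℝ g (x + ψ x) (φ x)) ≤ K * hnorm m α φ) ∧
    -- `g_⋆` is Fréchet differentiable at every `ψ₀` with this derivative
    (∀ ψ₀ : Euc d → Euc d, MemCb m α ψ₀ → ∀ ε > (0 : ℝ), ∃ δ > (0 : ℝ),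
      ∀ φ : Euc d → Euc d, MemCb m α φ → hnorm m α φ ≤ δ →
        hnorm m α (fun x =>
            g (x + ψ₀ x + φ x) - g (x + ψ₀ x) - fderiv ℝ g (x + ψ₀ x) (φ x)) ≤
          ε * hnorm m α φ) ∧
    -- the derivative depends continuously (in operator norm) on the base point
    (∀ ψ₀ : Euc d → Euc d, MemCb m α ψ₀ → ∀ ε > (0 : ℝ), ∃ δ > (0 : ℝ),
      ∀ ψ : Euc d → Euc d, MemCb m α ψ → hnorm m α (ψ - ψ₀) < δ →
        ∀ φ : Euc d → Euc d, MemCb m α φ →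
          hnorm m α (fun x => fderiv ℝ g (x + ψ x) (φ x) - fderiv ℝ g (x + ψ₀ x) (φ x)) ≤
            ε * hnorm m α φ) := by
  obtain ⟨n, rfl⟩ : ∃ n, m = n + 1 := ⟨m - 1, by omega⟩
  have hα1 : α ≤ 1 := hαβ.le.trans hβ
  have hg' := hg.holderBound (hα.trans hαβ)
  have hdg := hg'.2.2
  refine ⟨fun ψ hψ => ?_, fun ψ₀ hψ₀ ε hε => ?_, fun ψ₀ hψ₀ ε hε => ?_⟩
  · have hψ := hψ.holderBound hα
    obtain ⟨K, hK⟩ := hdg.exists_comp_id_add hα hαβ.le hβ hψ hψ.nonneg hψ.norm_sub_le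
    have key := fun φ (hφ : MemCb (n + 1) α φ) => hK.clm_apply hα hα1 (hφ.holderBound hα)
    refine ⟨fun φ hφ => (key φ hφ).memCb hα, 2 * 4 ^ (n + 1) * K, fun φ hφ => ?_⟩
    exact ((key φ hφ).hnorm_le hα).trans (le_of_eq (by ring))
  · have hψ₀ := hψ₀.holderBound hα
    obtain ⟨δ, hδ, H⟩ := hg'.exists_comp_id_add_remainder hα hαβ hβ hψ₀ hψ₀.nonneg
      hψ₀.norm_sub_le hε
    refine ⟨min δ 1, by positivity, fun φ hφ hφδ => ?_⟩
    have hφ := hφ.holderBound hα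
    exact (H φ _ hφ (hφδ.trans (min_le_left _ _))
      (hφ.mono (hφδ.trans (min_le_right _ _))).norm_sub_le).hnorm_le hα
  · have hψ₀ := hψ₀.holderBound hα
    have hD := hψ₀.nonneg
    obtain ⟨δ, hδ, H⟩ := hdg.exists_comp_id_add_sub (L := 1 + hnorm (n + 1) α ψ₀) hα hαβ hβ hψ₀
      (by positivity) (hψ₀.mono (by linarith)).norm_sub_le
      (show 0 < ε / (2 * 4 ^ (n + 1)) by positivity)
    refine ⟨min δ 1, by positivity, fun ψ hψ hψδ φ hφ => ?_⟩
    have hψ := hψ.holderBound hα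
    have hsub : HolderBound α (hnorm (n + 1) α (ψ - ψ₀)) (n + 1) (fun x => ψ x - ψ₀ x) :=
      (hψ.sub hψ₀ |>.memCb hα).holderBound hα
    have hψ' : HolderBound α (1 + hnorm (n + 1) α ψ₀) (n + 1) ψ := by
      simpa using (hsub.mono (hψδ.le.trans (min_le_right _ _))).add hψ₀
    have h := (H ψ (hsub.mono (hψδ.le.trans (min_le_left _ _))) hψ'.norm_sub_le).clm_apply hα hα1
      (hφ.holderBound hα)
    refine (h.hnorm_le hα).trans (le_of_eq ?_)
    field_simp
end

section
/- Let E, F be Banach spaces, U ⊆ E open, and let ω : [0,∞) → [0,∞) be an increasing, subadditive modulus of continuity with ω(0) = 0 and lim_{t→0} ω(t) = 0. For a map f : U → F the following are equivalent: (i) for every C^∞ curve c : ℝ → U and every bounded interval I ⊆ ℝ, the set { (f(c(t)) − f(c(s)))/ω(|t−s|) : t, s ∈ I, t ≠ s } is bounded in F; (ii) the quotient (f(x) − f(y))/ω(‖x−y‖) is locally bounded, i.e., every point of U has a neighborhood V ⊆ U and a constant C such that ‖f(x) − f(y)‖ ≤ C ω(‖x−y‖) for all x, y ∈ V. -/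
open Function Set Filter Topology

/-- A series of rescaled copies `ψ (2 ^ n * t) • a n` of a compactly supported smooth function is
smooth if the coefficients decay faster than any geometric sequence. -/
theorem contDiff_tsum_smul_rescale {E : Type*} [NormedAddCommGroup E] [NormedSpace ℝ E]
    [CompleteSpace E] {ψ : ℝ → ℝ} (hψ : ContDiff ℝ (⊤ : ℕ∞) ψ) (hc : HasCompactSupport ψ)
    {a : ℕ → E} (ha : ∀ k : ℕ, Summable fun n : ℕ => ((2 : ℝ) ^ n) ^ k * ‖a n‖) :
    ContDiff ℝ (⊤ : ℕ∞) fun t : ℝ => ∑' n : ℕ, ψ (2 ^ n * t) • a n := by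
  have hbound : ∀ k : ℕ, ∃ C : ℝ, ∀ u, ‖iteratedDeriv k ψ u‖ ≤ C := fun k => by
    obtain ⟨C, hC⟩ := (hc.iteratedFDeriv (𝕜 := ℝ) k).exists_bound_of_continuous
      (hψ.continuous_iteratedFDeriv (by exact_mod_cast le_top))
    exact ⟨C, fun u => by rw [← norm_iteratedFDeriv_eq_norm_iteratedDeriv]; exact hC u⟩
  choose C hC using hbound
  have hscale : ∀ n : ℕ, ContDiff ℝ (⊤ : ℕ∞) fun t : ℝ => ψ (2 ^ n * t) := fun n =>
    hψ.comp (contDiff_const.mul contDiff_id)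
  refine contDiff_tsum (v := fun k n => C k * (((2 : ℝ) ^ n) ^ k * ‖a n‖))
    (fun n => (hscale n).smul contDiff_const) (fun k _ => (ha k).mul_left _) ?_
  intro k n t _
  have hderiv : iteratedDeriv k (fun t : ℝ => ψ (2 ^ n * t) • a n) t
      = (((2 : ℝ) ^ n) ^ k * iteratedDeriv k ψ (2 ^ n * t)) • a n := by
    have hk : ContDiff ℝ k ψ := hψ.of_le (by exact_mod_cast le_top)
    have hkn : ContDiff ℝ k fun t : ℝ => ψ (2 ^ n * t) :=
      (hscale n).of_le (by exact_mod_cast le_top)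
    rw [iteratedDeriv_smul_const hkn.contDiffAt, iteratedDeriv_comp_const_mul hk]
  rw [norm_iteratedFDeriv_eq_norm_iteratedDeriv, hderiv, norm_smul, norm_mul, norm_pow, norm_pow,
    Real.norm_ofNat]
  calc ((2 : ℝ) ^ n) ^ k * ‖iteratedDeriv k ψ (2 ^ n * t)‖ * ‖a n‖
      ≤ ((2 : ℝ) ^ n) ^ k * C k * ‖a n‖ := by gcongr; exact hC k _
    _ = C k * (((2 : ℝ) ^ n) ^ k * ‖a n‖) := by ring

/-- The dyadic rescalings of the interval `(3/4, 5/4)` are pairwise disjoint. -/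
theorem eq_of_two_pow_mul_mem_Ioo {t : ℝ} {m n : ℕ} (hm : (2 : ℝ) ^ m * t ∈ Ioo (3 / 4) (5 / 4))
    (hn : (2 : ℝ) ^ n * t ∈ Ioo (3 / 4) (5 / 4)) : m = n := by
  wlog h : m < n generalizing m n
  · rcases (not_lt.mp h).eq_or_lt with h | h
    · exact h.symm
    · exact (this hn hm h).symm
  obtain ⟨d, rfl⟩ := Nat.exists_eq_add_of_lt h
  have hd : (1 : ℝ) ≤ 2 ^ d := one_le_pow₀ one_le_two
  have hpow : (2 : ℝ) ^ (m + d + 1) * t = 2 ^ d * 2 * (2 ^ m * t) := by ring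
  rw [hpow] at hn
  nlinarith [hm.1, hn.2]

/-- A smooth curve through a sequence of pairs: if `a n` and `b n` are small compared to
`1 / n!`, there is a smooth curve near `x₀` which equals `x₀ + a n + σ • b n` at time
`2⁻¹ ^ n * (1 + σ)` for all `0 ≤ σ ≤ 1/8`. -/
theorem exists_contDiff_curve_through {E : Type*} [NormedAddCommGroup E] [NormedSpace ℝ E]
    [CompleteSpace E] (x₀ : E) {ε : ℝ} (hε : 0 < ε) {a b : ℕ → E}
    (ha : ∀ n, ‖a n‖ ≤ ε * (1 / n.factorial)) (hb : ∀ n, ‖b n‖ ≤ ε * (1 / n.factorial)) :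
    ∃ c : ℝ → E, ContDiff ℝ (⊤ : ℕ∞) c ∧ (∀ t, ‖c t - x₀‖ ≤ 2 * ε) ∧
      ∀ n : ℕ, ∀ σ ∈ Icc (0 : ℝ) (1 / 8), c (2⁻¹ ^ n * (1 + σ)) = x₀ + a n + σ • b n := by
  let ψ : ContDiffBump (1 : ℝ) := ⟨1 / 8, 1 / 4, by norm_num, by norm_num⟩
  let χ : ℝ → ℝ := fun u => ψ u * (u - 1)
  have hψ0 : ∀ u, u ∉ Ioo (3 / 4 : ℝ) (5 / 4) → ψ u = 0 := fun u hu => by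
    apply ψ.zero_of_le_dist
    by_contra h
    rw [not_le, Real.dist_eq, abs_lt] at h
    change -(1 / 4) < u - 1 ∧ u - 1 < 1 / 4 at h
    exact hu ⟨by linarith [h.1], by linarith [h.2]⟩
  have hχ0 : ∀ u, u ∉ Ioo (3 / 4 : ℝ) (5 / 4) → χ u = 0 := fun u hu => by
    simp only [χ, hψ0 u hu, zero_mul]
  have hsummable : ∀ {d : ℕ → E}, (∀ n, ‖d n‖ ≤ ε * (1 / n.factorial)) → ∀ k : ℕ,
      Summable fun n : ℕ => ((2 : ℝ) ^ n) ^ k * ‖d n‖ := fun {d} hd k => by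
    refine Summable.of_nonneg_of_le (fun n => by positivity) (fun n => ?_)
      ((Real.summable_pow_div_factorial (2 ^ k)).mul_left ε)
    calc ((2 : ℝ) ^ n) ^ k * ‖d n‖ ≤ ((2 : ℝ) ^ n) ^ k * (ε * (1 / n.factorial)) := by
          gcongr; exact hd n
      _ = ε * ((2 ^ k) ^ n / n.factorial) := by rw [← pow_mul, ← pow_mul, mul_comm k n]; ring
  have hχ : ContDiff ℝ (⊤ : ℕ∞) χ := ψ.contDiff.mul (contDiff_id.sub contDiff_const)
  have hsingle : ∀ {g : ℝ → ℝ}, (∀ u, u ∉ Ioo (3 / 4 : ℝ) (5 / 4) → g u = 0) →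
      ∀ (d : ℕ → E) {t : ℝ} {n : ℕ}, (2 : ℝ) ^ n * t ∈ Ioo (3 / 4) (5 / 4) →
      ∑' m : ℕ, g (2 ^ m * t) • d m = g (2 ^ n * t) • d n := fun {g} hg d {t n} ht =>
    tsum_eq_single n fun m hm => by
      rw [hg _ fun h => hm (eq_of_two_pow_mul_mem_Ioo h ht), zero_smul]
  refine ⟨fun t => x₀ + ((∑' n : ℕ, ψ (2 ^ n * t) • a n) + ∑' n : ℕ, χ (2 ^ n * t) • b n),
    contDiff_const.add ((contDiff_tsum_smul_rescale ψ.contDiff ψ.hasCompactSupport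
      (hsummable ha)).add (contDiff_tsum_smul_rescale hχ ψ.hasCompactSupport.mul_right
      (hsummable hb))), fun t => ?_, fun n σ hσ => ?_⟩
  · rw [add_sub_cancel_left]
    by_cases h : ∃ n : ℕ, (2 : ℝ) ^ n * t ∈ Ioo (3 / 4) (5 / 4)
    · obtain ⟨n, hn⟩ := h
      have hle : ∀ {d : E} {r : ℝ}, ‖d‖ ≤ ε * (1 / n.factorial) → |r| ≤ 1 → ‖r • d‖ ≤ ε :=
        fun {d r} hd hr => by
          have hf : (1 : ℝ) / n.factorial ≤ 1 := by
            rw [div_le_one (by positivity)]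
            exact_mod_cast n.factorial_pos
          rw [norm_smul, Real.norm_eq_abs]
          nlinarith [norm_nonneg d, abs_nonneg r]
      have hψ1 : |ψ (2 ^ n * t)| ≤ 1 := by
        rw [abs_of_nonneg ψ.nonneg]
        exact ψ.le_one
      have hχ1 : |χ (2 ^ n * t)| ≤ 1 := by
        rw [abs_mul]
        refine mul_le_one₀ hψ1 (abs_nonneg _) ?_
        rw [abs_le]
        constructor <;> linarith [hn.1, hn.2]
      rw [hsingle hψ0 a hn, hsingle hχ0 b hn, two_mul]
      exact norm_add_le_of_le (hle (ha n) hψ1) (hle (hb n) hχ1)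
    · push Not at h
      simp only [hψ0 _ (h _), hχ0 _ (h _), zero_smul, tsum_zero, add_zero, norm_zero]
      positivity
  · have ht : (2 : ℝ) ^ n * (2⁻¹ ^ n * (1 + σ)) = 1 + σ := by
      rw [← mul_assoc, ← mul_pow]
      norm_num
    have hmem : (2 : ℝ) ^ n * (2⁻¹ ^ n * (1 + σ)) ∈ Ioo (3 / 4) (5 / 4) := by
      rw [ht]
      constructor <;> linarith [hσ.1, hσ.2]
    have hone : ψ (1 + σ) = 1 := ψ.one_of_mem_closedBall (by
      rw [Metric.mem_closedBall, Real.dist_eq, add_sub_cancel_left, abs_of_nonneg hσ.1]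
      exact hσ.2)
    simp only [hsingle hψ0 a hmem, hsingle hχ0 b hmem, ht, χ, hone]
    simp [add_assoc]

/-- A subadditive function vanishing at `0` satisfies `ω (N * t) ≤ N * ω t`. -/
theorem subadditive_natCast_mul_le {ω : ℝ → ℝ} (hω0 : ω 0 = 0)
    (hsub : ∀ s t : ℝ, 0 ≤ s → 0 ≤ t → ω (s + t) ≤ ω s + ω t) (N : ℕ) {t : ℝ} (ht : 0 ≤ t) :
    ω (N * t) ≤ N * ω t := by
  induction N with
  | zero => simp [hω0]
  | succ N ih =>
    push_cast
    rw [add_mul, one_mul, add_mul, one_mul]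
    linarith [hsub (N * t) t (by positivity) ht]

/-- Modulus-of-continuity bounds on a real interval follow from local ones. -/
theorem exists_modulus_bound_Icc_of_local {F : Type*} [SeminormedAddCommGroup F] {ω : ℝ → ℝ}
    (hω0 : ω 0 = 0) (hmono : MonotoneOn ω (Ici 0)) {g : ℝ → F}
    (hloc : ∀ t₀ : ℝ, ∃ W ∈ 𝓝 t₀, ∃ C : ℝ, ∀ s ∈ W, ∀ t ∈ W, s ≤ t →
      ‖g t - g s‖ ≤ C * ω (t - s)) {a b : ℝ} (hab : a ≤ b) :
    ∃ C : ℝ, ∀ s ∈ Icc a b, ∀ t ∈ Icc a b, s ≤ t → ‖g t - g s‖ ≤ C * ω (t - s) := by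
  have hpos : ∀ {t : ℝ}, 0 ≤ t → 0 ≤ ω t := fun {t} ht => hω0 ▸ hmono self_mem_Ici ht ht
  choose W hW C hC using hloc
  obtain ⟨τ, hτ0, hτmono, ⟨m, hm⟩, hτ⟩ := exists_monotone_Icc_subset_open_cover_Icc hab
    (c := fun t₀ : ℝ => (Subtype.val : Icc a b → ℝ) ⁻¹' interior (W t₀))
    (fun t₀ => isOpen_interior.preimage continuous_subtype_val)
    (fun t _ => mem_iUnion.mpr ⟨t, mem_interior_iff_mem_nhds.mpr (hW t)⟩)
  have hprefix : ∀ n : ℕ, ∃ C : ℝ, 0 ≤ C ∧ ∀ s ∈ Icc a (τ n : ℝ), ∀ t ∈ Icc a (τ n : ℝ), s ≤ t →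
      ‖g t - g s‖ ≤ C * ω (t - s) := fun n => by
    induction n with
    | zero =>
      refine ⟨0, le_rfl, fun s hs t ht _ => ?_⟩
      rw [hτ0] at hs ht
      simp [le_antisymm hs.2 hs.1, le_antisymm ht.2 ht.1]
    | succ n ih =>
      obtain ⟨K, hK0, hK⟩ := ih
      obtain ⟨t₀, ht₀⟩ := hτ n
      have hlast : ∀ s ∈ Icc (τ n : ℝ) (τ (n + 1)), ∀ t ∈ Icc (τ n : ℝ) (τ (n + 1)), s ≤ t →
          ‖g t - g s‖ ≤ |C t₀| * ω (t - s) := fun s hs t ht hst => by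
        have hsub : ∀ r ∈ Icc (τ n : ℝ) (τ (n + 1)), r ∈ W t₀ := fun r hr =>
          interior_subset (ht₀ (a := ⟨r, (τ n).2.1.trans hr.1, hr.2.trans (τ (n + 1)).2.2⟩)
            ⟨hr.1, hr.2⟩)
        exact (hC t₀ s (hsub s hs) t (hsub t ht) hst).trans
          (mul_le_mul_of_nonneg_right (le_abs_self _) (hpos (sub_nonneg.mpr hst)))
      refine ⟨K + |C t₀|, by positivity, fun s hs t ht hst => ?_⟩
      have hω := hpos (sub_nonneg.mpr hst)
      have hCω := mul_nonneg (abs_nonneg (C t₀)) hω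
      have hKω := mul_nonneg hK0 hω
      rw [add_mul]
      rcases le_total t (τ n) with h | h
      · linarith [hK s ⟨hs.1, hst.trans h⟩ t ⟨ht.1, h⟩ hst]
      rcases le_total (τ n : ℝ) s with h' | h'
      · linarith [hlast s ⟨h', hs.2⟩ t ⟨h, ht.2⟩ hst]
      have h1 := hK s ⟨hs.1, h'⟩ (τ n) ⟨(τ n).2.1, le_rfl⟩ h'
      have h2 := hlast (τ n) ⟨le_rfl, h.trans ht.2⟩ t ⟨h, ht.2⟩ h
      have h3 : ω (τ n - s) ≤ ω (t - s) :=
        hmono (sub_nonneg.mpr h') (sub_nonneg.mpr hst) (by linarith)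
      have h4 : ω (t - τ n) ≤ ω (t - s) :=
        hmono (sub_nonneg.mpr h) (sub_nonneg.mpr hst) (by linarith)
      have h5 := norm_sub_le_norm_sub_add_norm_sub (g t) (g (τ n)) (g s)
      have h6 := mul_le_mul_of_nonneg_left h3 hK0
      have h7 := mul_le_mul_of_nonneg_left h4 (abs_nonneg (C t₀))
      linarith
  obtain ⟨K, -, hK⟩ := hprefix m
  rw [hm m le_rfl] at hK
  exact ⟨K, hK⟩

/-- characterization of `C^{0,ω}`-maps between Banach spaces:
let `ω` be an increasing, subadditive modulus of continuity with `ω(0) = 0` and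
`ω(t) → 0` as `t → 0⁺`, let `U ⊆ E` be open and `f : U → F`.  Then `f` maps
smooth curves (with values in `U`) to `C^{0,ω}`-curves — i.e. difference
quotients along smooth curves are bounded on bounded intervals — if and only if
`(f(x) − f(y))/ω(‖x−y‖)` is locally bounded on `U`. -/
theorem stmt6 {E F : Type*} [NormedAddCommGroup E] [NormedSpace ℝ E] [CompleteSpace E]
    [NormedAddCommGroup F] [NormedSpace ℝ F] [CompleteSpace F]
    (U : Set E) (hU : IsOpen U) (ω : ℝ → ℝ)
    (hω0 : ω 0 = 0) (hmono : MonotoneOn ω (Ici 0))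
    (hsub : ∀ s t : ℝ, 0 ≤ s → 0 ≤ t → ω (s + t) ≤ ω s + ω t)
    (hlim : Tendsto ω (nhdsWithin 0 (Ioi 0)) (nhds 0))
    (f : E → F) :
    (∀ c : ℝ → E, ContDiff ℝ (⊤ : ℕ∞) c → (∀ t, c t ∈ U) →
      ∀ a b : ℝ, ∃ C : ℝ, ∀ s ∈ Icc a b, ∀ t ∈ Icc a b, s ≠ t →
        ‖f (c t) - f (c s)‖ ≤ C * ω |t - s|) ↔
    (∀ x₀ ∈ U, ∃ V ∈ 𝓝 x₀, V ⊆ U ∧ ∃ C : ℝ, ∀ x ∈ V, ∀ y ∈ V,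
        ‖f x - f y‖ ≤ C * ω ‖x - y‖) := by
  have hpos : ∀ {t : ℝ}, 0 ≤ t → 0 ≤ ω t := fun {t} ht => hω0 ▸ hmono self_mem_Ici ht ht
  constructor
  · intro hcurve x₀ hx₀
    by_contra hfail
    obtain ⟨δ, hδ, hball⟩ := Metric.isOpen_iff.mp hU x₀ hx₀
    obtain ⟨K, hK⟩ := exists_nat_gt (2 / δ)
    have hK0 : (0 : ℝ) < K := (by positivity : 0 < 2 / δ).trans hK
    let M : ℕ → ℕ := fun n => K * n.factorial
    have hM : ∀ n, (0 : ℝ) < M n := fun n => by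
      have := n.factorial_pos
      simp only [M, Nat.cast_mul]
      positivity
    have hMinv : ∀ n, (1 : ℝ) / M n = 1 / K * (1 / n.factorial) := fun n => by
      simp only [M, Nat.cast_mul]
      field_simp
    have hpairs : ∀ n : ℕ, ∃ x y : E, ‖x - x₀‖ < 1 / M n / 16 ∧ ‖y - x₀‖ < 1 / M n / 16 ∧
        n * M n * ω ‖x - y‖ < ‖f x - f y‖ := fun n => by
      by_contra! h
      refine hfail ⟨Metric.ball x₀ (min δ (1 / M n / 16)),
        Metric.ball_mem_nhds _ (lt_min hδ (by have := hM n; positivity)),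
        (Metric.ball_subset_ball (min_le_left _ _)).trans hball, n * M n, fun x hx y hy => ?_⟩
      rw [mem_ball_iff_norm] at hx hy
      exact h x y (hx.trans_le (min_le_right _ _)) (hy.trans_le (min_le_right _ _))
    choose x y hx hy hxy using hpairs
    have hne : ∀ n, 0 < ‖y n - x n‖ := fun n => by
      rw [norm_pos_iff, sub_ne_zero]
      intro h
      simpa [h, hω0] using hxy n
    let σ : ℕ → ℝ := fun n => M n * ‖y n - x n‖
    have hσ0 : ∀ n, 0 < σ n := fun n => mul_pos (hM n) (hne n)
    have hσ : ∀ n, σ n ≤ 1 / 8 := fun n => by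
      have h1 : ‖y n - x n‖ ≤ 1 / M n / 8 := by
        have := norm_sub_le_norm_sub_add_norm_sub (y n) x₀ (x n)
        rw [norm_sub_rev x₀] at this
        linarith [hx n, hy n]
      calc σ n ≤ M n * (1 / M n / 8) := mul_le_mul_of_nonneg_left h1 (hM n).le
        _ = 1 / 8 := by have := (hM n).ne'; field_simp
    obtain ⟨c, hc, hcx₀, hcn⟩ := exists_contDiff_curve_through x₀ (ε := 1 / K) (by positivity)
      (a := fun n => x n - x₀) (b := fun n => (σ n)⁻¹ • (y n - x n))
      (fun n => by
        rw [← hMinv]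
        have : (0 : ℝ) < 1 / M n := one_div_pos.mpr (hM n)
        linarith [hx n])
      (fun n => by
        rw [← hMinv, norm_smul, norm_inv, Real.norm_of_nonneg (hσ0 n).le]
        have h1 := (hM n).ne'
        have h2 := (hne n).ne'
        simp only [σ]
        apply le_of_eq
        field_simp)
    have hcU : ∀ t, c t ∈ U := fun t => hball (by
      rw [mem_ball_iff_norm]
      refine (hcx₀ t).trans_lt ?_
      rw [div_lt_iff₀ hδ] at hK
      rw [mul_one_div, div_lt_iff₀ hK0]
      linarith)
    obtain ⟨C, hC⟩ := hcurve c hc hcU 0 2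
    obtain ⟨n, hn⟩ := exists_nat_gt C
    have hcx : c (2⁻¹ ^ n) = x n := by
      simpa using hcn n 0 (by norm_num)
    have hcy : c (2⁻¹ ^ n * (1 + σ n)) = y n := by
      rw [hcn n _ ⟨(hσ0 n).le, hσ n⟩, smul_inv_smul₀ (hσ0 n).ne']
      abel
    have hp0 : (0 : ℝ) < 2⁻¹ ^ n := by positivity
    have hp1 : (2⁻¹ : ℝ) ^ n ≤ 1 := pow_le_one₀ (by norm_num) (by norm_num)
    have hstep : 0 < (2⁻¹ : ℝ) ^ n * σ n := mul_pos hp0 (hσ0 n)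
    have hstep' : (2⁻¹ : ℝ) ^ n * σ n ≤ σ n := mul_le_of_le_one_left (hσ0 n).le hp1
    have hle := hC (2⁻¹ ^ n) ⟨hp0.le, by linarith⟩ (2⁻¹ ^ n * (1 + σ n))
      ⟨by linarith, by linarith [hσ n]⟩ (by linarith)
    rw [hcx, hcy, show (2⁻¹ : ℝ) ^ n * (1 + σ n) - 2⁻¹ ^ n = 2⁻¹ ^ n * σ n by ring,
      abs_of_pos hstep] at hle
    have hω : ω (2⁻¹ ^ n * σ n) ≤ M n * ω ‖y n - x n‖ :=
      (hmono hstep.le (hσ0 n).le hstep').trans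
        (subadditive_natCast_mul_le hω0 hsub (M n) (norm_nonneg _))
    have hgt := hxy n
    rw [norm_sub_rev (x n), norm_sub_rev (f (x n)), mul_assoc] at hgt
    have h1 := mul_le_mul_of_nonneg_right hn.le (hpos hstep.le)
    have h2 := mul_le_mul_of_nonneg_left hω n.cast_nonneg (α := ℝ)
    linarith
  · intro hloc c hc hcU a b
    rcases lt_or_ge b a with hab | hab
    · exact ⟨0, fun s hs => absurd (hs.1.trans hs.2) (not_le.mpr hab)⟩
    obtain ⟨C, hC⟩ := exists_modulus_bound_Icc_of_local (g := f ∘ c) hω0 hmono (fun t₀ => by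
      obtain ⟨V, hV, -, C, hC⟩ := hloc (c t₀) (hcU t₀)
      obtain ⟨L, W, hW, hL⟩ := (hc.contDiffAt (x := t₀)).of_le
        (by exact_mod_cast le_top : (1 : WithTop ℕ∞) ≤ (⊤ : ℕ∞)) |>.exists_lipschitzOnWith
      obtain ⟨N, hN⟩ := exists_nat_ge (L : ℝ)
      refine ⟨W ∩ c ⁻¹' V, inter_mem hW (hc.continuous.continuousAt hV), |C| * N,
        fun s hs t ht hst => ?_⟩
      have hdist : ‖c t - c s‖ ≤ N * (t - s) := by
        have := hL.dist_le_mul t ht.1 s hs.1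
        rw [dist_eq_norm, Real.dist_eq, abs_of_nonneg (sub_nonneg.mpr hst)] at this
        exact this.trans (mul_le_mul_of_nonneg_right hN (sub_nonneg.mpr hst))
      calc ‖f (c t) - f (c s)‖ ≤ C * ω ‖c t - c s‖ := hC _ ht.2 _ hs.2
        _ ≤ |C| * ω ‖c t - c s‖ :=
          mul_le_mul_of_nonneg_right (le_abs_self C) (hpos (norm_nonneg _))
        _ ≤ |C| * (N * ω (t - s)) := mul_le_mul_of_nonneg_left
          ((hmono (norm_nonneg _) ((norm_nonneg _).trans hdist) hdist).trans
            (subadditive_natCast_mul_le hω0 hsub N (sub_nonneg.mpr hst))) (abs_nonneg C)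
        _ = |C| * N * ω (t - s) := (mul_assoc _ _ _).symm) hab
    refine ⟨C, fun s hs t ht _ => ?_⟩
    rcases le_total s t with h | h
    · rw [abs_of_nonneg (sub_nonneg.mpr h)]
      exact hC s hs t ht h
    · rw [abs_sub_comm, norm_sub_rev, abs_of_nonneg (sub_nonneg.mpr h)]
      exact hC t ht s hs h
end
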